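/- There exist constants C > 0, γ > 0 and N₀ such that for all n ≥ N₀ the following holds. Let P be an n×n probability matrix with ER-type core–periphery structure satisfying h(n) > p*, let r ∈ [n], and let A be a random adjacency matrix generated from P. Let M be the number of misclassified core nodes of Algorithm 1 run with the correct N_𝒞 and rank r, i.e. M = |𝒞 ∖ Ĉ| where Ĉ is the set of N_𝒞 indices with largest scores. Then with probability at least 1 − n^{−γ}, M ≤ C · max{r, rank(P)} · (max{√(n p*), √(log n)} + |λ_{r+1}|)² / (h(n) − p*)². -/

import Mathlib

open Matrix MeasureTheory ProbabilityTheory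

noncomputable section

/-- Euclidean norm of the `i`-th row of a matrix. -/
def rowNorm {n m : ℕ} (M : Matrix (Fin n) (Fin m) ℝ) (i : Fin n) : ℝ :=
  Real.sqrt (∑ j, (M i j) ^ 2)

/-- Two-to-infinity norm: maximum Euclidean norm of the rows. -/
def twoInf {n m : ℕ} (M : Matrix (Fin n) (Fin m) ℝ) : ℝ :=
  ⨆ i, rowNorm M i

/-- Spectral norm of a square real matrix. -/
def specNorm {n : ℕ} (M : Matrix (Fin n) (Fin n) ℝ) : ℝ :=
  ‖LinearMap.toContinuousLinearMap (Matrix.toEuclideanLin M)‖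

/-- Frobenius norm. -/
def frobNorm {n : ℕ} (M : Matrix (Fin n) (Fin n) ℝ) : ℝ :=
  Real.sqrt (∑ i, ∑ j, (M i j) ^ 2)

/-- The centering matrix `H = I - (1/n) 11ᵗ`. -/
def centerH (n : ℕ) : Matrix (Fin n) (Fin n) ℝ :=
  1 - (n : ℝ)⁻¹ • Matrix.of (fun _ _ => (1 : ℝ))

/-- A probability matrix: symmetric, entries in `[0,1]`, zero diagonal. -/
def IsProbMatrix {n : ℕ} (P : Matrix (Fin n) (Fin n) ℝ) : Prop :=
  P.IsSymm ∧ (∀ i j, 0 ≤ P i j) ∧ (∀ i j, P i j ≤ 1) ∧ (∀ i, P i i = 0)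

/-- Maximum entry `p* = max_{i,j} P_ij`. -/
def pstar {n : ℕ} (P : Matrix (Fin n) (Fin n) ℝ) : ℝ := ⨆ i, ⨆ j, P i j

/-- Expected degree `d_i = Σ_j P_ij`. -/
def deg {n : ℕ} (P : Matrix (Fin n) (Fin n) ℝ) (i : Fin n) : ℝ := ∑ j, P i j

open Classical in
/-- ER-type periphery set. -/
def peripheryER {n : ℕ} (P : Matrix (Fin n) (Fin n) ℝ) : Finset (Fin n) :=
  Finset.univ.filter fun i => ∀ j k, j ≠ i → k ≠ i → P i j = P i k

/-- ER-type core set. -/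
def coreER {n : ℕ} (P : Matrix (Fin n) (Fin n) ℝ) : Finset (Fin n) :=
  (peripheryER P)ᶜ

/-- `h(n) = min_{i ∈ core} ‖P_{i,*} H‖₂`. -/
def hSignal {n : ℕ} (P : Matrix (Fin n) (Fin n) ℝ) : ℝ :=
  ⨅ i : {i // i ∈ coreER P}, rowNorm (P * centerH n) i.1

open Classical in
/-- Configuration-type periphery set. -/
def peripheryConfig {n : ℕ} (P : Matrix (Fin n) (Fin n) ℝ) : Finset (Fin n) :=
  Finset.univ.filter fun i => ∀ j, j ≠ i → P i j = deg P i * deg P j / ∑ k, deg P k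

/-- Configuration-type core set. -/
def coreConfig {n : ℕ} (P : Matrix (Fin n) (Fin n) ℝ) : Finset (Fin n) :=
  (peripheryConfig P)ᶜ

/-- Diagonal matrix with entries `(d i)⁻¹`, i.e. `D⁻¹`. -/
def degInv {n : ℕ} (d : Fin n → ℝ) : Matrix (Fin n) (Fin n) ℝ :=
  Matrix.diagonal fun i => (d i)⁻¹

/-- `h'(n) = min_{i ∈ core} ‖P_{i,*} D⁻¹ H‖₂`. -/
def hSignal' {n : ℕ} (P : Matrix (Fin n) (Fin n) ℝ) : ℝ :=
  ⨅ i : {i // i ∈ coreConfig P}, rowNorm (P * degInv (deg P) * centerH n) i.1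

/-- Eigendecomposition `P = V Λ Vᵗ` with eigenvalues ordered by decreasing absolute value. -/
def IsEigenDecomp {n : ℕ} (P V : Matrix (Fin n) (Fin n) ℝ) (lam : Fin n → ℝ) : Prop :=
  V * Vᵀ = 1 ∧ P = V * Matrix.diagonal lam * Vᵀ ∧
    ∀ i j : Fin n, i ≤ j → |lam j| ≤ |lam i|

/-- `T` is a rank-`r` spectral truncation of `A`: it retains, from an eigendecomposition of `A`
ordered by decreasing absolute value, the `r` leading eigenvalues and their eigenvectors. -/
def IsSpecTrunc {n : ℕ} (r : ℕ) (A T : Matrix (Fin n) (Fin n) ℝ) : Prop :=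
  ∃ (W : Matrix (Fin n) (Fin n) ℝ) (mu : Fin n → ℝ), IsEigenDecomp A W mu ∧
    T = W * Matrix.diagonal (fun i : Fin n => if (i : ℕ) < r then mu i else 0) * Wᵀ

/-- `U`: the `n × r` matrix of the top-`r` eigenvectors (first `r` columns of `V`). -/
def topEig {n : ℕ} (V : Matrix (Fin n) (Fin n) ℝ) (r : ℕ) (h : r ≤ n) :
    Matrix (Fin n) (Fin r) ℝ :=
  fun i k => V i (Fin.castLE h k)

/-- `A` is a random adjacency matrix generated from `P`: symmetric, zero diagonal, 0/1 entries,
with `A_ij ~ Bernoulli(P_ij)` independently over pairs `i < j`. -/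
def IsAdjacencyModel {n : ℕ} {Ω : Type*} [MeasurableSpace Ω] (μ : Measure Ω)
    (P : Matrix (Fin n) (Fin n) ℝ) (A : Ω → Matrix (Fin n) (Fin n) ℝ) : Prop :=
  (∀ ω, (A ω).IsSymm) ∧ (∀ ω i, A ω i i = 0) ∧
  (∀ ω i j, A ω i j = 0 ∨ A ω i j = 1) ∧
  (∀ i j : Fin n, Measurable fun ω => A ω i j) ∧
  (∀ i j : Fin n, i < j → μ {ω | A ω i j = 1} = ENNReal.ofReal (P i j)) ∧
  iIndepFun
    (fun (p : {q : Fin n × Fin n // q.1 < q.2}) => fun ω => A ω p.1.1 p.1.2) μ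

/-- Exact recovery: every core score strictly exceeds every non-core score, so the
`N_core` indices with largest scores are exactly the core. -/
def ExactRecovery {n : ℕ} (S : Fin n → ℝ) (core : Finset (Fin n)) : Prop :=
  ∀ i ∈ core, ∀ j ∉ core, S j < S i

/-- `B(r) = 10 min{r, 1 + log₂ ratio}` where `ratio = |λ₁/λ_r|`. -/
def Bconst (ratio : ℝ) (r : ℕ) : ℝ := 10 * min (r : ℝ) (1 + Real.logb 2 ratio)


def walkProd {n : ℕ} (M : Matrix (Fin n) (Fin n) ℝ) {m : ℕ} (w : Fin (m+1) → Fin n) : ℝ :=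
  ∏ i : Fin m, M (w i.castSucc) (w i.succ)

lemma pow_apply_walk {n : ℕ} (M : Matrix (Fin n) (Fin n) ℝ) (m : ℕ) (a b : Fin n) :
    (M ^ m) a b = ∑ w : Fin (m+1) → Fin n,
      if w 0 = a ∧ w (Fin.last m) = b then walkProd M w else 0 := by
  induction m generalizing a with
  | zero =>
    rw [← (Equiv.funUnique (Fin 1) (Fin n)).symm.sum_comp]
    simp only [walkProd, pow_zero, Matrix.one_apply, Finset.univ_eq_empty, Finset.prod_empty]
    by_cases h : a = b
    · subst h; simp
    · rw [if_neg h, eq_comm]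
      apply Finset.sum_eq_zero
      intro x _
      rw [if_neg]
      rintro ⟨h1, h2⟩
      exact h (h1.symm.trans h2)
  | succ m ih =>
    rw [pow_succ', Matrix.mul_apply]
    simp_rw [ih]
    rw [← (Fin.consEquiv (fun _ => Fin n)).sum_comp, Fintype.sum_prod_type]
    symm
    rw [Finset.sum_eq_single_of_mem a (Finset.mem_univ _)]
    · simp_rw [Finset.mul_sum]
      symm
      rw [Finset.sum_comm]
      apply Finset.sum_congr rfl
      intro w _
      rw [Finset.sum_eq_single_of_mem (w 0) (Finset.mem_univ _)]
      · have hl : (Fin.consEquiv (fun _ => Fin n)) (a, w) (Fin.last (m+1)) = w (Fin.last m) := by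
          simp [Fin.consEquiv, ← Fin.succ_last]
        rw [hl]
        simp only [walkProd, Fin.prod_univ_succ, Fin.consEquiv]
        by_cases h : w (Fin.last m) = b <;> simp [h]
      · intro x _ hx
        rw [if_neg (fun h => hx h.1.symm), mul_zero]
    · intro x _ hx
      apply Finset.sum_eq_zero
      intro w _
      rw [if_neg]
      rintro ⟨h1, _⟩
      exact hx h1

lemma trace_pow_walk {n : ℕ} (M : Matrix (Fin n) (Fin n) ℝ) (m : ℕ) :
    (M ^ m).trace = ∑ w : Fin (m+1) → Fin n,
      if w 0 = w (Fin.last m) then walkProd M w else 0 := by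
  simp only [Matrix.trace, Matrix.diag, pow_apply_walk]
  rw [Finset.sum_comm]
  apply Finset.sum_congr rfl
  intro w _
  rw [Finset.sum_eq_single_of_mem (w 0) (Finset.mem_univ _)]
  · simp [eq_comm]
  · intro x _ hx
    rw [if_neg (fun h => hx h.1.symm)]

def GoodW {α : Type*} {m : ℕ} (w : Fin (m+1) → α) : Prop :=
  w 0 = w (Fin.last m) ∧ (∀ i : Fin m, w i.castSucc ≠ w i.succ) ∧
  ∀ i : Fin m, ∃ j : Fin m, j ≠ i ∧ s(w i.castSucc, w i.succ) = s(w j.castSucc, w j.succ)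

lemma goodW_congr {α β : Type*} {m : ℕ} (w : Fin (m+1) → α) (w' : Fin (m+1) → β)
    (h : ∀ i j, w i = w j ↔ w' i = w' j) : GoodW w ↔ GoodW w' := by
  simp only [GoodW, Sym2.eq_iff, ne_eq, h]

open Classical in
lemma vertex_le_edge {α : Type*} {m : ℕ} (w : Fin (m+1) → α) :
    (Finset.univ.image w).card ≤
      (Finset.univ.image (fun i : Fin m => s(w i.castSucc, w i.succ))).card + 1 := by
  induction m with
  | zero =>
    refine (Finset.card_image_le).trans ?_
    simp
  | succ m ih =>
    have ih' := ih (fun i => w i.castSucc)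
    have h1 : Finset.univ.image w =
        insert (w (Fin.last _)) (Finset.univ.image (fun i : Fin (m+1) => w i.castSucc)) := by
      ext x
      simp only [Finset.mem_image, Finset.mem_univ, true_and, Finset.mem_insert]
      rw [Fin.exists_fin_succ']
      constructor
      · rintro (h | h)
        · exact Or.inr h
        · exact Or.inl h.symm
      · rintro (h | h)
        · exact Or.inr h.symm
        · exact Or.inl h
    have h2 : Finset.univ.image (fun i : Fin (m+1) => s(w i.castSucc, w i.succ)) =
        insert s(w (Fin.last m).castSucc, w (Fin.last _)) (Finset.univ.image
          (fun i : Fin m => s(w i.castSucc.castSucc, w i.succ.castSucc))) := by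
      ext x
      simp only [Finset.mem_image, Finset.mem_univ, true_and, Finset.mem_insert]
      rw [Fin.exists_fin_succ']
      constructor
      · rintro (h | h)
        · exact Or.inr h
        · exact Or.inl h.symm
      · rintro (h | h)
        · exact Or.inr h.symm
        · exact Or.inl h
    rw [h1, h2]
    by_cases hm : w (Fin.last _) ∈ Finset.univ.image (fun i : Fin (m+1) => w i.castSucc)
    · rw [Finset.insert_eq_of_mem hm]
      refine ih'.trans ?_
      have := Finset.card_le_card (Finset.subset_insert s(w (Fin.last m).castSucc, w (Fin.last _)) (Finset.univ.image
          (fun i : Fin m => s(w i.castSucc.castSucc, w i.succ.castSucc))))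
      simpa using this
    · rw [Finset.card_insert_of_notMem hm, Finset.card_insert_of_notMem]
      · exact Nat.add_le_add_right ih' 1
      · intro hc
        simp only [Finset.mem_image, Finset.mem_univ, true_and] at hc hm
        obtain ⟨i, hi⟩ := hc
        rw [Sym2.eq_iff] at hi
        rcases hi with ⟨_, h⟩ | ⟨h, _⟩
        · exact hm ⟨_, h⟩
        · exact hm ⟨_, h⟩

open Classical in
lemma good_edge_le {α : Type*} {m : ℕ} (w : Fin (m+1) → α) (h : GoodW w) :
    2 * (Finset.univ.image (fun i : Fin m => s(w i.castSucc, w i.succ))).card ≤ m := by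
  have h3 := Finset.mul_card_image_le_card (f := fun i : Fin m => s(w i.castSucc, w i.succ))
    (Finset.univ : Finset (Fin m)) 2 (by
      intro b hb
      simp only [Finset.mem_image, Finset.mem_univ, true_and] at hb
      obtain ⟨i, rfl⟩ := hb
      obtain ⟨j, hj, hij⟩ := h.2.2 i
      rw [← Finset.card_pair hj]
      apply Finset.card_le_card
      intro x hx
      simp only [Finset.mem_insert, Finset.mem_singleton] at hx
      rcases hx with rfl | rfl
      · simp [hij]
      · simp)
  simpa using h3

open Classical in
lemma count_ker {ι α : Type*} [Fintype ι] (w0 : ι → α) (N : ℕ) :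
    (Finset.univ.filter (fun w : ι → Fin N => ∀ i j, w i = w j ↔ w0 i = w0 j)).card
      = N.descFactorial (Finset.univ.image w0).card := by
  have e : {w : ι → Fin N // ∀ i j, w i = w j ↔ w0 i = w0 j} ≃ (Set.range w0 ↪ Fin N) :=
    { toFun := fun w => ⟨fun x => w.1 x.2.choose, by
        intro x y hxy
        have := (w.2 _ _).1 hxy
        rw [x.2.choose_spec, y.2.choose_spec] at this
        exact Subtype.ext this⟩
      invFun := fun f => ⟨fun i => f ⟨w0 i, i, rfl⟩, by
        intro i j
        exact f.injective.eq_iff.trans Subtype.ext_iff⟩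
      left_inv := by
        intro w
        ext i
        have : w.1 (⟨w0 i, i, rfl⟩ : Set.range w0).2.choose = w.1 i := by
          rw [w.2]
          exact (⟨w0 i, i, rfl⟩ : Set.range w0).2.choose_spec
        exact congrArg Fin.val this
      right_inv := by
        intro f
        ext x
        have : (⟨w0 x.2.choose, x.2.choose, rfl⟩ : Set.range w0) = x := Subtype.ext x.2.choose_spec
        change ((f ⟨w0 x.2.choose, x.2.choose, rfl⟩ : Fin N) : ℕ) = f x
        rw [this] }
  rw [← Fintype.card_subtype, Fintype.card_congr e, Fintype.card_embedding_eq, Fintype.card_fin]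
  congr 1
  rw [← Set.toFinset_card]
  congr 1
  ext; simp

lemma desc_ineq (n r k v : ℕ) (p : ℝ) (hp : 0 ≤ p) (h : (k:ℝ) + n * p ≤ r) (hv : v ≤ k) :
    (r:ℝ) * (n.descFactorial (v+1) * p ^ v) ≤ n * r.descFactorial (v+1) := by
  have hr : k ≤ r := by
    have : (k:ℝ) ≤ r := by nlinarith [mul_nonneg (Nat.cast_nonneg (α := ℝ) n) hp]
    exact_mod_cast this
  rcases Nat.eq_zero_or_pos r with rfl | hr0
  · simp only [Nat.cast_zero, zero_mul]; positivity
  obtain ⟨r, rfl⟩ : ∃ r', r = r' + 1 := ⟨r - 1, by omega⟩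
  have h1 : (n.descFactorial (v+1) : ℝ) ≤ (n:ℝ) ^ (v+1) := by
    exact_mod_cast Nat.descFactorial_le_pow n (v+1)
  have h2 : ((n:ℝ) * p) ^ v ≤ r.descFactorial v := by
    have h3 : (((r + 1 - v) ^ v : ℕ) : ℝ) ≤ r.descFactorial v := by
      exact_mod_cast Nat.pow_sub_le_descFactorial r v
    refine le_trans ?_ h3
    rw [Nat.cast_pow]
    apply pow_le_pow_left₀ (by positivity)
    rw [Nat.cast_sub (by omega)]
    have : (v:ℝ) ≤ k := by exact_mod_cast hv
    linarith
  rw [Nat.succ_descFactorial_succ]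
  push_cast
  have h4 : (n.descFactorial (v+1) : ℝ) * p ^ v ≤ n * ((n:ℝ) * p) ^ v := by
    calc (n.descFactorial (v+1) : ℝ) * p ^ v ≤ (n:ℝ) ^ (v+1) * p ^ v := by gcongr
      _ = n * ((n:ℝ) * p) ^ v := by rw [mul_pow]; ring
  calc ((r:ℝ)+1) * (n.descFactorial (v+1) * p ^ v) ≤ ((r:ℝ)+1) * (n * ((n:ℝ) * p) ^ v) := by gcongr
    _ ≤ ((r:ℝ)+1) * (n * r.descFactorial v) := by gcongr
    _ = _ := by ring

open Classical in
lemma walk_compare (n r k : ℕ) (p : ℝ) (hp : 0 ≤ p) (h : (k:ℝ) + n * p ≤ r) :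
    (r:ℝ) * ∑ w : Fin (2*k+1) → Fin n,
        (if GoodW w then p ^ ((Finset.univ.image w).card - 1) else 0)
      ≤ n * ∑ w : Fin (2*k+1) → Fin r, (if GoodW w then (1:ℝ) else 0) := by
  rw [← Finset.sum_fiberwise (s := (Finset.univ : Finset (Fin (2*k+1) → Fin n)))
      (g := fun w => fun i j => w i = w j),
    ← Finset.sum_fiberwise (s := (Finset.univ : Finset (Fin (2*k+1) → Fin r)))
      (g := fun w => fun i j => w i = w j), Finset.mul_sum, Finset.mul_sum]
  apply Finset.sum_le_sum
  intro κ _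
  by_cases hex : ∃ w0 : Fin (2*k+1) → Fin n, GoodW w0 ∧ (fun i j => w0 i = w0 j) = κ
  · obtain ⟨w0, hg, rfl⟩ := hex
    have hf : ∀ N, (Finset.univ.filter (fun w : Fin (2*k+1) → Fin N =>
        (fun i j => w i = w j) = (fun i j => w0 i = w0 j)))
        = Finset.univ.filter (fun w => ∀ i j, w i = w j ↔ w0 i = w0 j) := by
      intro N
      ext w
      simp only [Finset.mem_filter, Finset.mem_univ, true_and]
      constructor
      · intro h i j
        exact iff_of_eq (congrFun (congrFun h i) j)
      · intro h
        funext i j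
        exact propext (h i j)
    rw [hf, hf]
    set v := (Finset.univ.image w0).card with hvdef
    have hv1 : 1 ≤ v := by
      rw [Nat.one_le_iff_ne_zero, ← Nat.pos_iff_ne_zero, Finset.card_pos]
      exact ⟨w0 0, by simp⟩
    have hv2 : v ≤ k + 1 := by
      have h1 : v ≤ (Finset.univ.image (fun i : Fin (2*k) =>
          s(w0 i.castSucc, w0 i.succ))).card + 1 := by
        convert vertex_le_edge w0
      have h2 : 2 * (Finset.univ.image (fun i : Fin (2*k) =>
          s(w0 i.castSucc, w0 i.succ))).card ≤ 2 * k := by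
        convert good_edge_le w0 hg
      omega
    have hcard : ∀ w : Fin (2*k+1) → Fin n, (∀ i j, w i = w j ↔ w0 i = w0 j) →
        (Finset.univ.image w).card = v := by
      intro w hw
      refine Finset.card_bij' (i := fun x hx => w0 (Finset.mem_image.1 hx).choose)
        (j := fun x hx => w (Finset.mem_image.1 hx).choose) ?_ ?_ ?_ ?_
      · intro x hx; simp
      · intro x hx; simp
      · intro x hx
        have h1 := (Finset.mem_image.1 hx).choose_spec.2
        refine Eq.trans ?_ h1
        rw [hw]
        generalize_proofs a b
        exact b.choose_spec.2
      · intro x hx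
        have h1 := (Finset.mem_image.1 hx).choose_spec.2
        refine Eq.trans ?_ h1
        rw [← hw]
        generalize_proofs a b
        exact b.choose_spec.2
    rw [Finset.sum_congr rfl (g := fun _ => p ^ (v-1)), Finset.sum_congr (s₁ := Finset.filter _
      (Finset.univ : Finset (Fin (2*k+1) → Fin r))) rfl (g := fun _ => (1:ℝ))]
    · have hc : ∀ N, (Finset.univ.filter (fun w : Fin (2*k+1) → Fin N =>
          ∀ i j, w i = w j ↔ w0 i = w0 j)).card = N.descFactorial v := by
        intro N
        convert count_ker w0 N
      rw [Finset.sum_const, Finset.sum_const, hc, hc]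
      obtain ⟨u, hu⟩ : ∃ u, v = u + 1 := ⟨v - 1, by omega⟩
      rw [hu]
      simpa using desc_ineq n r k u p hp h (by omega)
    · intro w hw
      rw [if_pos]
      rw [goodW_congr w w0 (by simpa using hw)]
      exact hg
    · intro w hw
      have hw' : ∀ i j, w i = w j ↔ w0 i = w0 j := by simpa using hw
      rw [if_pos, hcard w hw']
      rw [goodW_congr w w0 hw']
      exact hg
  · push Not at hex
    rw [Finset.sum_eq_zero, mul_zero]
    · apply mul_nonneg (Nat.cast_nonneg _)
      apply Finset.sum_nonneg
      intro w _
      split_ifs <;> norm_num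
    · intro w hw
      rw [if_neg]
      intro hg
      exact hex w hg (by simpa using hw)

abbrev EdgeT (n : ℕ) := {q : Fin n × Fin n // q.1 < q.2}

lemma edgeT_ext {n : ℕ} (e f : EdgeT n) (h : s(e.1.1, e.1.2) = s(f.1.1, f.1.2)) : e = f := by
  obtain ⟨⟨a, b⟩, hab⟩ := e
  obtain ⟨⟨c, d⟩, hcd⟩ := f
  simp only [Sym2.eq_iff] at h
  rcases h with ⟨rfl, rfl⟩ | ⟨rfl, rfl⟩
  · rfl
  · exact absurd hab (not_lt.2 (le_of_lt hcd))

lemma exists_edge {n : ℕ} (a b : Fin n) (h : a ≠ b) : ∃ e : EdgeT n, s(e.1.1, e.1.2) = s(a, b) := by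
  rcases lt_or_gt_of_ne h with h | h
  · exact ⟨⟨(a, b), h⟩, rfl⟩
  · exact ⟨⟨(b, a), h⟩, Sym2.eq_swap⟩

open Classical in
lemma walkProd_edges {n m : ℕ} (w : Fin (m+1) → Fin n) (hnl : ∀ i : Fin m, w i.castSucc ≠ w i.succ) :
    ∃ c : EdgeT n → ℕ,
      (∀ Y : Matrix (Fin n) (Fin n) ℝ, Y.IsSymm → walkProd Y w = ∏ e, Y e.1.1 e.1.2 ^ c e) ∧
      (w 0 = w (Fin.last m) → (GoodW w ↔ ∀ e, c e ≠ 1)) ∧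
      (Finset.univ.image w).card - 1 ≤ (Finset.univ.filter (fun e => c e ≠ 0)).card := by
  choose ε hε using fun i => exists_edge _ _ (hnl i)
  have hinj : ∀ i j, ε i = ε j ↔ s(w i.castSucc, w i.succ) = s(w j.castSucc, w j.succ) := by
    intro i j
    constructor
    · intro h
      rw [← hε i, ← hε j, h]
    · intro h
      apply edgeT_ext
      rw [hε, hε, h]
  refine ⟨fun e => (Finset.univ.filter (fun i => ε i = e)).card, ?_, ?_, ?_⟩
  · intro Y hY
    have h1 : ∀ i : Fin m, Y (w i.castSucc) (w i.succ) = Y (ε i).1.1 (ε i).1.2 := by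
      intro i
      have h := hε i
      rw [Sym2.eq_iff] at h
      rcases h with ⟨h1, h2⟩ | ⟨h1, h2⟩
      · rw [h1, h2]
      · rw [h1, h2]; exact hY.apply _ _
    simp only [walkProd, h1]
    rw [← Finset.prod_fiberwise (s := Finset.univ) (g := ε)]
    apply Finset.prod_congr rfl
    intro e _
    rw [← Finset.prod_const]
    apply Finset.prod_congr rfl
    intro i hi
    simp only [Finset.mem_filter, Finset.mem_univ, true_and] at hi
    rw [hi]
  · intro hcl
    constructor
    · rintro ⟨_, _, h⟩ e he
      rw [Finset.card_eq_one] at he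
      obtain ⟨i, hi⟩ := he
      have hi' : ε i = e := by
        have : i ∈ Finset.univ.filter (fun i => ε i = e) := by rw [hi]; simp
        simpa using this
      obtain ⟨j, hj, hij⟩ := h i
      have : j ∈ Finset.univ.filter (fun i => ε i = e) := by
        simp only [Finset.mem_filter, Finset.mem_univ, true_and]
        rw [← hi', eq_comm, hinj]
        exact hij
      rw [hi, Finset.mem_singleton] at this
      exact hj this
    · intro h
      refine ⟨hcl, hnl, fun i => ?_⟩
      have h0 : 0 < (Finset.univ.filter (fun j => ε j = ε i)).card := by
        rw [Finset.card_pos]; exact ⟨i, by simp⟩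
      have h1 := h (ε i)
      have h2 : 1 < (Finset.univ.filter (fun j => ε j = ε i)).card := lt_of_le_of_ne h0 (Ne.symm h1)
      obtain ⟨j, hj, hji⟩ := Finset.exists_mem_ne h2 i
      refine ⟨j, hji, ?_⟩
      rw [← hinj]
      simp only [Finset.mem_filter, Finset.mem_univ, true_and] at hj
      exact hj.symm
  · have h1 := vertex_le_edge w
    have h2 : (Finset.univ.image (fun i : Fin m => s(w i.castSucc, w i.succ))).card ≤
        (Finset.univ.filter (fun e => (Finset.univ.filter (fun i => ε i = e)).card ≠ 0)).card := by
      refine (Finset.card_le_card ?_).trans (Finset.card_image_le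
        (f := fun e : EdgeT n => s(e.1.1, e.1.2)))
      intro x hx
      simp only [Finset.mem_image, Finset.mem_univ, true_and] at hx
      obtain ⟨i, rfl⟩ := hx
      rw [Finset.mem_image]
      refine ⟨ε i, ?_, hε i⟩
      simp only [Finset.mem_filter, Finset.mem_univ, true_and]
      rw [← Nat.pos_iff_ne_zero, Finset.card_pos]
      exact ⟨i, by simp⟩
    have h3 : (Finset.univ.image w).card ≤
      (Finset.univ.image (fun i : Fin m => s(w i.castSucc, w i.succ))).card + 1 := by
      convert h1
    exact (Nat.sub_le_of_le_add h3).trans h2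

lemma walkProd_loop {n m : ℕ} (Y : Matrix (Fin n) (Fin n) ℝ) (hd : ∀ i, Y i i = 0)
    (w : Fin (m+1) → Fin n) (h : ¬ ∀ i : Fin m, w i.castSucc ≠ w i.succ) : walkProd Y w = 0 := by
  push Not at h
  obtain ⟨i, hi⟩ := h
  apply Finset.prod_eq_zero (Finset.mem_univ i)
  rw [← hi, hd]

/-! ### Comparison matrix -/

noncomputable def rW (b : Bool) : ℝ := if b then 1/3 else 2/3
noncomputable def rV (b : Bool) : ℝ := if b then 2 else -1

noncomputable def rE {r : ℕ} (F : (EdgeT r → Bool) → ℝ) : ℝ := ∑ s, (∏ e, rW (s e)) * F s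

noncomputable def rM {r : ℕ} (s : EdgeT r → Bool) : Matrix (Fin r) (Fin r) ℝ := fun i j =>
  if h : i < j then rV (s ⟨(i, j), h⟩) else if h : j < i then rV (s ⟨(j, i), h⟩) else 0

lemma rM_symm {r : ℕ} (s : EdgeT r → Bool) : (rM s).IsSymm := by
  ext i j
  simp only [rM, Matrix.transpose_apply]
  rcases lt_trichotomy i j with h | h | h
  · simp [h, not_lt.2 h.le]
  · subst h; simp
  · simp [h, not_lt.2 h.le]

lemma rM_diag {r : ℕ} (s : EdgeT r → Bool) (i) : rM s i i = 0 := by simp [rM]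

lemma rM_edge {r : ℕ} (s : EdgeT r → Bool) (e : EdgeT r) : rM s e.1.1 e.1.2 = rV (s e) := by
  have := e.2
  simp [rM, this]

lemma rW_pos (b : Bool) : 0 < rW b := by cases b <;> norm_num [rW]

lemma rE_mono {r : ℕ} (F G : (EdgeT r → Bool) → ℝ) (h : ∀ s, F s ≤ G s) : rE F ≤ rE G := by
  apply Finset.sum_le_sum
  intro s _
  exact mul_le_mul_of_nonneg_left (h s) (Finset.prod_nonneg fun e _ => (rW_pos _).le)

lemma rE_sum {r : ℕ} {ι : Type*} (t : Finset ι) (F : ι → (EdgeT r → Bool) → ℝ) :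
    rE (fun s => ∑ i ∈ t, F i s) = ∑ i ∈ t, rE (F i) := by
  simp only [rE, Finset.mul_sum]
  rw [Finset.sum_comm]

lemma rE_smul {r : ℕ} (c : ℝ) (F : (EdgeT r → Bool) → ℝ) :
    rE (fun s => c * F s) = c * rE F := by
  simp only [rE, Finset.mul_sum]
  apply Finset.sum_congr rfl
  intro s _
  ring

lemma rE_prod {r : ℕ} (f : EdgeT r → Bool → ℝ) :
    rE (fun s => ∏ e, f e (s e)) = ∏ e, (∑ b, rW b * f e b) := by
  rw [Finset.prod_univ_sum, Fintype.piFinset_univ]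
  simp only [rE, Finset.prod_mul_distrib]

lemma rV_moment (m : ℕ) : ∑ b, rW b * rV b ^ m = (2 ^ m + 2 * (-1) ^ m) / 3 := by
  simp [rW, rV]
  ring

lemma rV_moment_one : ∑ b, rW b * rV b ^ 1 = 0 := by
  rw [rV_moment]; norm_num

lemma rV_moment_ge (m : ℕ) (h : m ≠ 1) : 1 ≤ ∑ b, rW b * rV b ^ m := by
  rw [rV_moment]
  rcases Nat.lt_or_ge m 3 with hm | hm
  · interval_cases m
    · norm_num
    · exact absurd rfl h
    · norm_num
  · have h1 : (2:ℝ)^3 ≤ 2 ^ m := pow_le_pow_right₀ (by norm_num) hm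
    have h2 : (-1:ℝ) ≤ (-1)^m := by
      rcases neg_one_pow_eq_or ℝ m with h | h <;> rw [h]; norm_num
    linarith

open Classical in
lemma rE_trace_lower (r m : ℕ) :
    ∑ w : Fin (m+1) → Fin r, (if GoodW w then (1:ℝ) else 0) ≤
      rE (fun s : EdgeT r → Bool => ((rM s) ^ m).trace) := by
  simp only [trace_pow_walk]
  rw [rE_sum]
  apply Finset.sum_le_sum
  intro w _
  by_cases hcl : w 0 = w (Fin.last m)
  · simp only [if_pos hcl]
    by_cases hnl : ∀ i : Fin m, w i.castSucc ≠ w i.succ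
    · obtain ⟨c, h1, h2, _⟩ := walkProd_edges w hnl
      simp only [h1 _ (rM_symm _), rM_edge]
      rw [rE_prod (fun e b => rV b ^ c e)]
      by_cases hg : GoodW w
      · rw [if_pos hg]
        have h3 := (h2 hcl).1 hg
        calc (1:ℝ) = ∏ e : EdgeT r, 1 := by simp
          _ ≤ _ := Finset.prod_le_prod (fun _ _ => zero_le_one) (fun e _ => rV_moment_ge _ (h3 e))
      · rw [if_neg hg]
        have h3 := mt (h2 hcl).2 hg
        push Not at h3
        obtain ⟨e, he⟩ := h3
        rw [Finset.prod_eq_zero (Finset.mem_univ e)]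
        rw [he, rV_moment_one]
    · rw [if_neg (fun h => hnl h.2.1)]
      simp only [walkProd_loop _ (rM_diag _) w hnl]
      simp [rE]
  · rw [if_neg (fun h => hcl h.1)]
    simp [hcl, rE]

/-! ### Moments of the centered adjacency matrix -/

open Classical in
lemma adj_trace_upper {n : ℕ} {Ω : Type*} [MeasurableSpace Ω] (μ : Measure Ω)
    [IsProbabilityMeasure μ] (p : ℝ) (hp0 : 0 ≤ p) (hp1 : p ≤ 1)
    (X : Ω → Matrix (Fin n) (Fin n) ℝ) (hs : ∀ ω, (X ω).IsSymm) (hd : ∀ ω i, X ω i i = 0)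
    (hm : ∀ i j, Measurable fun ω => X ω i j) (hb : ∀ ω i j, |X ω i j| ≤ 1)
    (hmean : ∀ e : EdgeT n, ∫ ω, X ω e.1.1 e.1.2 ∂μ = 0)
    (hvar : ∀ e : EdgeT n, ∫ ω, (X ω e.1.1 e.1.2)^2 ∂μ ≤ p)
    (hind : iIndepFun (fun (e : EdgeT n) => fun ω => X ω e.1.1 e.1.2) μ) (m : ℕ) :
    Integrable (fun ω => ((X ω) ^ m).trace) μ ∧
    ∫ ω, ((X ω) ^ m).trace ∂μ ≤ ∑ w : Fin (m+1) → Fin n,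
        (if GoodW w then p ^ ((Finset.univ.image w).card - 1) else 0) := by
  have hIntegr : ∀ w : Fin (m+1) → Fin n, Integrable (fun ω => walkProd (X ω) w) μ := by
    intro w
    apply Integrable.of_bound (C := 1)
    · apply Measurable.aestronglyMeasurable
      unfold walkProd
      fun_prop
    · refine ae_of_all _ fun ω => ?_
      rw [walkProd, Real.norm_eq_abs, Finset.abs_prod]
      exact Finset.prod_le_one (fun _ _ => abs_nonneg _) (fun _ _ => hb _ _ _)
  have hIntegr' : ∀ w : Fin (m+1) → Fin n, Integrable (fun ω =>
      if w 0 = w (Fin.last m) then walkProd (X ω) w else 0) μ := by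
    intro w
    split_ifs
    · exact hIntegr w
    · simp
  simp only [trace_pow_walk]
  refine ⟨integrable_finsetSum _ fun w _ => hIntegr' w, ?_⟩
  rw [integral_finsetSum _ fun w _ => hIntegr' w]
  apply Finset.sum_le_sum
  intro w _
  by_cases hcl : w 0 = w (Fin.last m)
  · simp only [if_pos hcl]
    by_cases hnl : ∀ i : Fin m, w i.castSucc ≠ w i.succ
    · obtain ⟨c, h1, h2, h4⟩ := walkProd_edges w hnl
      simp only [h1 _ (hs _)]
      rw [hind.integral_fun_prod_comp (f := fun e x => x ^ c e) (fun e => (hm _ _).aemeasurable)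
        (fun e => by fun_prop)]
      by_cases hg : GoodW w
      · rw [if_pos hg]
        have h3 := (h2 hcl).1 hg
        refine (le_abs_self _).trans ?_
        rw [Finset.abs_prod]
        calc ∏ e, |∫ ω, X ω e.1.1 e.1.2 ^ c e ∂μ| ≤ ∏ e, (if c e ≠ 0 then p else 1) := by
              apply Finset.prod_le_prod (fun _ _ => abs_nonneg _)
              intro e _
              by_cases h0 : c e = 0
              · simp [h0]
              · rw [if_pos h0]
                have h2' : 2 ≤ c e := by have := h3 e; omega
                refine (abs_integral_le_integral_abs).trans (le_trans ?_ (hvar e))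
                apply integral_mono_of_nonneg (ae_of_all _ fun _ => abs_nonneg _)
                · apply Integrable.of_bound (C := 1)
                  · exact ((hm _ _).pow_const 2).aestronglyMeasurable
                  · refine ae_of_all _ fun ω => ?_
                    rw [Real.norm_eq_abs, abs_pow]
                    exact pow_le_one₀ (abs_nonneg _) (hb _ _ _)
                · refine ae_of_all _ fun ω => ?_
                  simp only
                  rw [abs_pow, ← sq_abs]
                  exact pow_le_pow_of_le_one (abs_nonneg _) (hb _ _ _) h2'
          _ = p ^ (Finset.univ.filter (fun e => c e ≠ 0)).card := by
              rw [Finset.prod_ite, Finset.prod_const, Finset.prod_const_one, mul_one]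
          _ ≤ _ := pow_le_pow_of_le_one hp0 hp1 h4
      · rw [if_neg hg]
        have h3 := mt (h2 hcl).2 hg
        push Not at h3
        obtain ⟨e, he⟩ := h3
        rw [Finset.prod_eq_zero (Finset.mem_univ e)]
        simp only [he, pow_one]
        exact hmean e
    · rw [if_neg (fun h => hnl h.2.1)]
      simp only [walkProd_loop _ (hd _) w hnl]
      simp
  · rw [if_neg (fun h => hcl h.1)]
    simp [hcl]

/-! ### Spectral facts -/

lemma spectral_exists {n : ℕ} (M : Matrix (Fin n) (Fin n) ℝ) (hM : M.IsSymm) :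
    ∃ (V : Matrix (Fin n) (Fin n) ℝ) (lam : Fin n → ℝ), V * Vᵀ = 1 ∧ Vᵀ * V = 1 ∧
      M = V * Matrix.diagonal lam * Vᵀ ∧
      M.rank = (Finset.univ.filter (fun i => lam i ≠ 0)).card := by
  have hH : M.IsHermitian := by
    rw [Matrix.IsHermitian, Matrix.conjTranspose_eq_transpose_of_trivial]; exact hM
  have hu := (hH.eigenvectorUnitary).2
  have hs : star (hH.eigenvectorUnitary : Matrix (Fin n) (Fin n) ℝ)
      = (hH.eigenvectorUnitary : Matrix (Fin n) (Fin n) ℝ)ᵀ := by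
    rw [Matrix.star_eq_conjTranspose, Matrix.conjTranspose_eq_transpose_of_trivial]
  refine ⟨hH.eigenvectorUnitary, hH.eigenvalues, ?_, ?_, ?_, ?_⟩
  · rw [← hs]; exact Matrix.mem_unitaryGroup_iff.1 hu
  · rw [← hs]; exact Matrix.mem_unitaryGroup_iff'.1 hu
  · have := hH.spectral_theorem
    rw [Unitary.conjStarAlgAut_apply] at this
    rw [← hs]
    exact this
  · rw [hH.rank_eq_card_non_zero_eigs, Fintype.card_subtype]

lemma orth_conj_pow {n : ℕ} (V : Matrix (Fin n) (Fin n) ℝ) (lam : Fin n → ℝ) (h1 : V * Vᵀ = 1)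
    (h2 : Vᵀ * V = 1) (m : ℕ) :
    (V * Matrix.diagonal lam * Vᵀ) ^ m = V * Matrix.diagonal (fun i => lam i ^ m) * Vᵀ := by
  induction m with
  | zero => simp [h1]
  | succ m ih =>
    rw [pow_succ, ih]
    calc V * Matrix.diagonal (fun i => lam i ^ m) * Vᵀ * (V * Matrix.diagonal lam * Vᵀ)
        = V * Matrix.diagonal (fun i => lam i ^ m) * (Vᵀ * V) * Matrix.diagonal lam * Vᵀ := by
          simp only [Matrix.mul_assoc]
      _ = _ := by
          rw [h2, Matrix.mul_one, Matrix.mul_assoc V, Matrix.diagonal_mul_diagonal]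
          simp only [pow_succ]

lemma trace_conj {n : ℕ} (V : Matrix (Fin n) (Fin n) ℝ) (lam : Fin n → ℝ)
    (h2 : Vᵀ * V = 1) : (V * Matrix.diagonal lam * Vᵀ).trace = ∑ i, lam i := by
  rw [Matrix.trace_mul_comm, ← Matrix.mul_assoc, h2, Matrix.one_mul, Matrix.trace_diagonal]

lemma quad_conj {n : ℕ} (V : Matrix (Fin n) (Fin n) ℝ) (lam : Fin n → ℝ) (x : Fin n → ℝ) :
    x ⬝ᵥ ((V * Matrix.diagonal lam * Vᵀ) *ᵥ x) = ∑ i, lam i * (Vᵀ *ᵥ x) i ^ 2 := by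
  rw [← Matrix.mulVec_mulVec, ← Matrix.mulVec_mulVec, Matrix.dotProduct_mulVec,
    ← Matrix.mulVec_transpose]
  simp only [dotProduct, Matrix.mulVec_diagonal]
  apply Finset.sum_congr rfl
  intro i _
  ring

lemma norm_orth {n : ℕ} (V : Matrix (Fin n) (Fin n) ℝ) (h1 : V * Vᵀ = 1) (x : Fin n → ℝ) :
    ∑ i, (Vᵀ *ᵥ x) i ^ 2 = ∑ i, x i ^ 2 := by
  have h := quad_conj V (fun _ => 1) x
  have hd : Matrix.diagonal (fun _ : Fin n => (1:ℝ)) = 1 := Matrix.diagonal_one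
  rw [hd, Matrix.mul_one, h1, Matrix.one_mulVec] at h
  simp only [one_mul] at h
  rw [← h]
  simp [dotProduct, sq]

/-! ### The net -/

abbrev NetI (r : ℕ) := Fin r → Bool × Fin (3 * r + 1)

noncomputable def netV {r : ℕ} (x : NetI r) (i : Fin r) : ℝ :=
  (if (x i).1 then 1 else -1) * ((x i).2 : ℕ)

noncomputable def netT (r : ℕ) : Finset (NetI r) :=
  Finset.univ.filter (fun x => ∑ i, (netV x i) ^ 2 ≤ 9 * r)

lemma netV_sq {r : ℕ} (x : NetI r) (i : Fin r) : (netV x i)^2 = (((x i).2 : ℕ) : ℝ)^2 := by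
  unfold netV
  split_ifs <;> ring

lemma netT_card (r : ℕ) : ((netT r).card : ℝ) ≤ 2 ^ (11 * r) := by
  have h1 : ∀ x ∈ netT r, (1:ℝ) ≤ 2 ^ (9 * r) * ∏ i, (1/2 : ℝ) ^ ((x i).2 : ℕ) := by
    intro x hx
    rw [netT, Finset.mem_filter] at hx
    rw [Finset.prod_pow_eq_pow_sum]
    have h2 : ∑ i, ((x i).2 : ℕ) ≤ 9 * r := by
      have : ((∑ i, ((x i).2 : ℕ) : ℕ) : ℝ) ≤ ((9 * r : ℕ) : ℝ) := by
        push_cast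
        refine le_trans (Finset.sum_le_sum fun i _ => ?_) hx.2
        rw [netV_sq]
        exact_mod_cast Nat.le_self_pow (by norm_num) _
      exact_mod_cast this
    calc (1:ℝ) = 2 ^ (9 * r) * (1/2) ^ (9*r) := by rw [← mul_pow]; norm_num
      _ ≤ _ := by
        gcongr ?_ * ?_
        exact pow_le_pow_of_le_one (by norm_num) (by norm_num) h2
  calc ((netT r).card : ℝ) = ∑ x ∈ netT r, (1:ℝ) := by simp
    _ ≤ ∑ x ∈ netT r, 2 ^ (9 * r) * ∏ i, (1/2 : ℝ) ^ ((x i).2 : ℕ) := Finset.sum_le_sum h1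
    _ ≤ ∑ x : NetI r, 2 ^ (9 * r) * ∏ i, (1/2 : ℝ) ^ ((x i).2 : ℕ) :=
        Finset.sum_le_sum_of_subset_of_nonneg (Finset.subset_univ _) (fun _ _ _ => by positivity)
    _ = 2 ^ (9*r) * ∏ i : Fin r, ∑ y : Bool × Fin (3*r+1), (1/2 : ℝ) ^ (y.2 : ℕ) := by
        rw [Finset.prod_univ_sum, Fintype.piFinset_univ, Finset.mul_sum]
    _ ≤ 2 ^ (9*r) * ∏ i : Fin r, (4:ℝ) := by
        gcongr
        rw [Fintype.sum_prod_type]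
        simp only [Fintype.sum_bool, Fin.sum_univ_eq_sum_range (fun j => (1/2:ℝ)^j)]
        have := sum_geometric_two_le (3*r+1)
        linarith
    _ = _ := by
        rw [Finset.prod_const, Finset.card_univ, Fintype.card_fin]
        rw [show (4:ℝ) = 2^2 by norm_num, ← pow_mul, ← pow_add]
        congr 1
        ring

lemma net_approx {r : ℕ} (t : Fin r → ℝ) (ht : ∑ i, t i ^ 2 ≤ 9 * r) :
    ∃ x ∈ netT r, ∀ i, |netV x i - t i| ≤ 1 := by
  have hb : ∀ i, |t i| ≤ 3 * r := by
    intro i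
    have h1 : t i ^ 2 ≤ 9 * r := (Finset.single_le_sum (f := fun i => t i ^ 2)
      (fun _ _ => sq_nonneg _) (Finset.mem_univ i)).trans ht
    have hr : (1:ℝ) ≤ r := by exact_mod_cast i.pos
    apply abs_le_of_sq_le_sq' _ (by positivity) |> abs_le.2
    nlinarith
  have hfl : ∀ i, ⌊|t i|⌋₊ < 3 * r + 1 := by
    intro i
    rw [Nat.lt_succ_iff]
    apply Nat.floor_le_of_le
    push_cast
    exact hb i
  refine ⟨fun i => (decide (0 ≤ t i), ⟨⌊|t i|⌋₊, hfl i⟩), ?_, ?_⟩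
  · rw [netT, Finset.mem_filter]
    refine ⟨Finset.mem_univ _, le_trans (Finset.sum_le_sum fun i _ => ?_) ht⟩
    rw [netV_sq, ← sq_abs (t i)]
    exact pow_le_pow_left₀ (Nat.cast_nonneg _) (Nat.floor_le (abs_nonneg _)) 2
  · intro i
    have h1 := Nat.floor_le (abs_nonneg (t i))
    have h2 := (Nat.lt_floor_add_one |t i|).le
    simp only [netV, decide_eq_true_eq]
    split_ifs with h
    · rw [abs_of_nonneg h] at *
      rw [abs_le]; constructor <;> linarith
    · rw [abs_of_neg (not_le.1 h)] at *
      rw [abs_le]; constructor <;> linarith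

lemma trace_le_net {r k : ℕ} (M : Matrix (Fin r) (Fin r) ℝ) (hM : M.IsSymm) :
    (M ^ (2*k)).trace ≤ r * ∑ x ∈ netT r, ((netV x ⬝ᵥ (M *ᵥ netV x)) / (2 * r)) ^ (2*k) := by
  obtain ⟨V, lam, h1, h2, h3, _⟩ := spectral_exists M hM
  rcases Nat.eq_zero_or_pos r with rfl | hr
  · simp [Matrix.trace]
  have hr' : (0:ℝ) < r := by exact_mod_cast hr
  have : Nonempty (Fin r) := ⟨⟨0, hr⟩⟩
  obtain ⟨j, hj⟩ := Finite.exists_max (fun i => |lam i|)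
  rw [h3, orth_conj_pow V lam h1 h2, trace_conj _ _ h2]
  have hsum : ∑ i, lam i ^ (2*k) ≤ r * |lam j| ^ (2*k) := by
    calc ∑ i, lam i ^ (2*k) ≤ ∑ i : Fin r, |lam j| ^ (2*k) := by
          apply Finset.sum_le_sum
          intro i _
          rw [← Even.pow_abs (even_two_mul k)]
          exact pow_le_pow_left₀ (abs_nonneg _) (hj i) _
      _ = _ := by simp
  refine hsum.trans ?_
  gcongr

  set v : Fin r → ℝ := fun i => V i j with hv
  have hVv : Vᵀ *ᵥ v = Pi.single j 1 := by
    ext i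
    have := congrFun (congrFun h2 i) j
    rw [Matrix.mul_apply] at this
    simp only [Matrix.mulVec, dotProduct, hv]
    rw [this, Matrix.one_apply, Pi.single_apply]
  have hvn : ∑ i, v i ^ 2 = 1 := by
    rw [← norm_orth V h1, hVv]
    simp [Pi.single_apply]
  set a : ℝ := 3 * Real.sqrt r with ha
  have hsq : Real.sqrt r ^ 2 = r := Real.sq_sqrt hr'.le
  obtain ⟨x, hx, hxt⟩ := net_approx (fun i => a * v i) (by
    simp only [mul_pow, ← Finset.mul_sum, hvn, ha, hsq]; norm_num)
  set δ : Fin r → ℝ := fun i => netV x i - a * v i with hδ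
  have hxd : netV x = a • v + δ := by
    ext i; simp [hδ]
  have hδn : ∑ i, δ i ^ 2 ≤ r := by
    calc ∑ i, δ i ^ 2 ≤ ∑ i : Fin r, (1:ℝ) := by
          apply Finset.sum_le_sum
          intro i _
          rw [← sq_abs]
          exact pow_le_one₀ (abs_nonneg _) (hxt i)
      _ = r := by simp
  set d := Vᵀ *ᵥ δ with hd
  have hdn : ∑ i, d i ^ 2 ≤ r := by rw [hd, norm_orth V h1]; exact hδn
  have hdj : |d j| ≤ Real.sqrt r := by
    apply Real.abs_le_sqrt
    exact (Finset.single_le_sum (f := fun i => d i ^ 2)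
      (fun _ _ => sq_nonneg _) (Finset.mem_univ j)).trans hdn
  have hq : netV x ⬝ᵥ (V * Matrix.diagonal lam * Vᵀ) *ᵥ netV x
      = lam j * (a^2 + 2 * a * d j) + ∑ i, lam i * d i ^ 2 := by
    rw [quad_conj, hxd, Matrix.mulVec_add, Matrix.mulVec_smul, hVv, ← hd]
    have : ∀ i, lam i * ((a • (Pi.single j 1 : Fin r → ℝ) + d) i)^2
        = (if i = j then lam i * (a^2 + 2 * a * d i) else 0) + lam i * d i ^ 2 := by
      intro i
      simp only [Pi.add_apply, Pi.smul_apply, Pi.single_apply, smul_eq_mul]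
      split_ifs <;> ring
    simp only [this, Finset.sum_add_distrib]
    simp
  have hrem : |∑ i, lam i * d i ^ 2| ≤ |lam j| * r := by
    refine (Finset.abs_sum_le_sum_abs _ _).trans ?_
    calc ∑ i, |lam i * d i ^ 2| ≤ ∑ i, |lam j| * d i ^ 2 := by
          apply Finset.sum_le_sum
          intro i _
          rw [abs_mul, abs_of_nonneg (sq_nonneg (d i))]
          exact mul_le_mul_of_nonneg_right (hj i) (sq_nonneg _)
      _ = |lam j| * ∑ i, d i ^ 2 := by rw [Finset.mul_sum]
      _ ≤ _ := by gcongr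
  have hmain : 2 * r * |lam j| ≤ |netV x ⬝ᵥ (V * Matrix.diagonal lam * Vᵀ) *ᵥ netV x| := by
    rw [hq]
    have h5 : 3 * r ≤ a^2 + 2 * a * d j := by
      have := (abs_le.1 hdj).1
      have hs0 := Real.sqrt_nonneg (r:ℝ)
      rw [ha]
      nlinarith
    have h6 : |lam j| * (3 * r) ≤ |lam j * (a^2 + 2 * a * d j)| := by
      rw [abs_mul]
      gcongr
      exact h5.trans (le_abs_self _)
    have h7 := abs_sub_abs_le_abs_sub (lam j * (a^2 + 2 * a * d j)) (-∑ i, lam i * d i ^ 2)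
    rw [abs_neg, sub_neg_eq_add] at h7
    linarith
  refine le_trans ?_ (Finset.single_le_sum (f := fun x : NetI r =>
    ((netV x ⬝ᵥ ((V * Matrix.diagonal lam * Vᵀ) *ᵥ netV x)) / (2 * r)) ^ (2*k))
    (fun _ _ => Even.pow_nonneg (even_two_mul k) _) hx)
  rw [← Even.pow_abs (even_two_mul k) (_ / _)]
  apply pow_le_pow_left₀ (abs_nonneg _)
  rw [abs_div, abs_of_pos (show (0:ℝ) < 2 * r by positivity), le_div_iff₀ (by positivity)]
  linarith

/-! ### Moment bound for the comparison matrix -/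

lemma sum_edges {r : ℕ} (f : Fin r → Fin r → ℝ) (hs : ∀ i j, f i j = f j i) (hd : ∀ i, f i i = 0) :
    ∑ i, ∑ j, f i j = ∑ e : EdgeT r, 2 * f e.1.1 e.1.2 := by
  have h1 : ∑ e : EdgeT r, 2 * f e.1.1 e.1.2
      = ∑ q : Fin r × Fin r, if q.1 < q.2 then 2 * f q.1 q.2 else 0 := by
    rw [← Finset.sum_filter]
    exact (Finset.sum_subtype _ (by simp) (fun q : Fin r × Fin r => 2 * f q.1 q.2)).symm
  rw [h1, Fintype.sum_prod_type]
  have h2 : ∀ i j, f i j = (if i < j then f i j else 0) + (if j < i then f j i else 0) := by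
    intro i j
    rcases lt_trichotomy i j with h | h | h
    · simp [h, not_lt.2 h.le]
    · subst h; simp [hd]
    · simp [h, not_lt.2 h.le, hs i j]
  calc ∑ i, ∑ j, f i j = ∑ i, ∑ j, ((if i < j then f i j else 0) + (if j < i then f j i else 0)) := by
        apply Finset.sum_congr rfl; intro i _; apply Finset.sum_congr rfl; intro j _; exact h2 i j
    _ = (∑ i, ∑ j, if i < j then f i j else 0) + ∑ i, ∑ j, (if j < i then f j i else 0) := by
        simp only [Finset.sum_add_distrib]
    _ = (∑ i, ∑ j, if i < j then f i j else 0) + ∑ i, ∑ j, (if i < j then f i j else 0) := by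
        congr 1
        rw [Finset.sum_comm]
    _ = _ := by
        rw [← Finset.sum_add_distrib]
        apply Finset.sum_congr rfl; intro i _
        rw [← Finset.sum_add_distrib]
        apply Finset.sum_congr rfl; intro j _
        simp only
        split_ifs <;> ring

lemma exp_le_add (y : ℝ) : Real.exp y ≤ y + Real.exp (y^2) := by
  have h0 := Real.add_one_le_exp (y^2)
  rcases le_or_gt |y| 1 with h | h
  · have := (abs_le.1 (Real.abs_exp_sub_one_sub_id_le h)).2
    linarith
  · rcases le_or_gt 0 y with hy | hy
    · rw [abs_of_nonneg hy] at h
      have : Real.exp y ≤ Real.exp (y^2) := Real.exp_le_exp.2 (by nlinarith)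
      linarith
    · rw [abs_of_neg hy] at h
      have : Real.exp y ≤ 1 := Real.exp_le_one_iff.2 hy.le
      nlinarith

lemma rV_mgf (c : ℝ) : ∑ b, rW b * Real.exp (c * rV b) ≤ Real.exp (4 * c^2) := by
  simp only [Fintype.sum_bool, rW, rV, if_true, Bool.false_eq_true, if_false]
  have h1 := exp_le_add (c * 2)
  have h2 := exp_le_add (c * -1)
  have h3 : Real.exp ((c*2)^2) = Real.exp (4 * c^2) := by ring_nf
  have h4 : Real.exp ((c * -1)^2) ≤ Real.exp (4 * c^2) := Real.exp_le_exp.2 (by nlinarith [sq_nonneg c])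
  linarith

lemma rE_exp {r : ℕ} (c : EdgeT r → ℝ) :
    rE (fun s => Real.exp (∑ e, c e * rV (s e))) ≤ Real.exp (4 * ∑ e, c e ^ 2) := by
  simp only [Real.exp_sum]
  rw [rE_prod (fun e b => Real.exp (c e * rV b)), Finset.mul_sum, Real.exp_sum]
  apply Finset.prod_le_prod
  · intro e _
    exact Finset.sum_nonneg fun b _ => mul_nonneg (rW_pos b).le (Real.exp_pos _).le
  · intro e _
    exact rV_mgf _

lemma rE_pow {r : ℕ} (c : EdgeT r → ℝ) (k : ℕ) (hk : 1 ≤ k) (B : ℝ) (hB : ∑ e, c e ^ 2 ≤ B) :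
    rE (fun s => (∑ e, c e * rV (s e)) ^ (2*k)) ≤ 2 * (4 * k * Real.exp (4 * B)) ^ k := by
  have hk' : (0:ℝ) < k := by exact_mod_cast hk
  set t := Real.sqrt k with ht
  have htp : 0 < t := Real.sqrt_pos.2 hk'
  have ht2 : t^2 = k := Real.sq_sqrt hk'.le
  have hpt : ∀ y : ℝ, y ^ (2*k) ≤ (4 * k) ^ k *
      (Real.exp (t * y) + Real.exp (-(t * y))) := by
    intro y
    have h1 := Real.pow_div_factorial_le_exp (|t * y|) (abs_nonneg _) (2*k)
    rw [div_le_iff₀ (by positivity), Even.pow_abs (even_two_mul k), mul_pow] at h1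
    have h2 : Real.exp |t * y| ≤ Real.exp (t * y) + Real.exp (-(t * y)) := by
      rcases abs_choice (t*y) with h | h <;> rw [h]
      · linarith [Real.exp_pos (-(t*y))]
      · linarith [Real.exp_pos (t*y)]
    have h3 : ((2*k).factorial : ℝ) ≤ (2 * k) ^ (2*k) := by
      exact_mod_cast Nat.factorial_le_pow (2*k)
    have h4 : t ^ (2*k) = (k:ℝ)^k := by rw [pow_mul, ht2]
    rw [h4] at h1
    have h5 : ((2:ℝ) * k) ^ (2*k) = (k:ℝ)^k * (4 * k)^k := by
      rw [pow_mul, ← mul_pow]; congr 1; ring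
    have h6 : (k:ℝ)^k * y^(2*k) ≤ (k:ℝ)^k * ((4 * k) ^ k *
      (Real.exp (t * y) + Real.exp (-(t * y)))) := by
      refine h1.trans ?_
      calc Real.exp |t*y| * (2*k).factorial ≤ (Real.exp (t * y) + Real.exp (-(t * y))) * (2*k)^(2*k) := by
            gcongr
        _ = _ := by rw [h5]; ring
    exact le_of_mul_le_mul_left h6 (by positivity)
  have hside : ∀ σ : ℝ, σ^2 = k → rE (fun s => Real.exp (∑ e, (σ * c e) * rV (s e))) ≤ Real.exp (4 * B) ^ k := by
    intro σ hσ
    refine (rE_exp _).trans ?_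
    rw [← Real.exp_nat_mul, Real.exp_le_exp]
    simp only [mul_pow, ← Finset.mul_sum, hσ]
    nlinarith
  refine (rE_mono _ _ (fun s => hpt _)).trans ?_
  rw [rE_smul]
  have hadd : rE (fun s : EdgeT r → Bool => Real.exp (t * ∑ e, c e * rV (s e)) + Real.exp (-(t * ∑ e, c e * rV (s e))))
     = rE (fun s => Real.exp (∑ e, (t * c e) * rV (s e))) + rE (fun s => Real.exp (∑ e, ((-t) * c e) * rV (s e))) := by
    simp only [rE, ← Finset.sum_add_distrib, ← mul_add]
    apply Finset.sum_congr rfl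
    intro s _
    congr 3
    · rw [Finset.mul_sum]; simp only [mul_assoc]
    · rw [Finset.mul_sum, ← Finset.sum_neg_distrib]
      apply Finset.sum_congr rfl; intro e _; ring
  rw [hadd]
  have := hside t ht2
  have := hside (-t) (by rw [neg_sq, ht2])
  rw [mul_pow (4 * (k:ℝ))]
  calc (4 * (k:ℝ))^k * _ ≤ (4 * (k:ℝ))^k * (Real.exp (4 * B) ^ k + Real.exp (4 * B) ^ k) := by gcongr
    _ = _ := by ring

lemma rE_trace_upper (k : ℕ) (hk : 1 ≤ k) :
    rE (fun s : EdgeT (2*k) → Bool => ((rM s) ^ (2*k)).trace) ≤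
      ((2*k : ℕ) : ℝ) * (Real.exp 187 * k) ^ k := by
  set r := 2 * k with hr
  have hr0 : (0:ℝ) < r := by rw [hr]; exact_mod_cast (by omega : 0 < 2 * k)
  refine (rE_mono _ _ (fun s => trace_le_net (k := k) (rM s) (rM_symm s))).trans ?_
  rw [rE_smul, rE_sum]
  have hx : ∀ x ∈ netT r, rE (fun s : EdgeT r → Bool =>
      ((netV x ⬝ᵥ ((rM s) *ᵥ netV x)) / (2 * r)) ^ (2*k)) ≤ 2 * (4 * k * Real.exp (4 * (81/2))) ^ k := by
    intro x hx
    rw [netT, Finset.mem_filter] at hx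
    have hq : ∀ s : EdgeT r → Bool, (netV x ⬝ᵥ ((rM s) *ᵥ netV x)) / (2 * r)
        = ∑ e : EdgeT r, (netV x e.1.1 * netV x e.1.2 / r) * rV (s e) := by
      intro s
      have h1 : netV x ⬝ᵥ ((rM s) *ᵥ netV x) = ∑ i, ∑ j, netV x i * (rM s i j * netV x j) := by
        simp only [dotProduct, Matrix.mulVec, Finset.mul_sum]
      rw [h1, sum_edges _ (fun i j => by rw [(rM_symm s).apply i j]; ring) (fun i => by rw [rM_diag]; ring),
        Finset.sum_div]
      apply Finset.sum_congr rfl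
      intro e _
      rw [rM_edge]
      field_simp
    simp only [hq]
    apply rE_pow _ k hk
    have h2 : ∑ e : EdgeT r, (netV x e.1.1 * netV x e.1.2)^2 ≤ (9 * r)^2 / 2 := by
      have h3 := sum_edges (fun i j : Fin r => if i = j then 0 else (netV x i * netV x j)^2)
        (fun i j => by
          by_cases h : i = j
          · subst h; rfl
          · simp [h, Ne.symm h, mul_comm]) (fun i => by simp)
      have h4 : ∑ i, ∑ j, (if i = j then 0 else (netV x i * netV x j)^2) ≤ (9 * (r:ℝ))^2 := by
        calc _ ≤ ∑ i, ∑ j, (netV x i)^2 * (netV x j)^2 := by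
              apply Finset.sum_le_sum; intro i _; apply Finset.sum_le_sum; intro j _
              split_ifs
              · positivity
              · rw [mul_pow]
          _ = (∑ i, netV x i ^ 2)^2 := by rw [sq (∑ i, _), Finset.sum_mul_sum]
          _ ≤ _ := pow_le_pow_left₀ (Finset.sum_nonneg fun _ _ => sq_nonneg _) hx.2 2
      rw [h3, ← Finset.mul_sum] at h4
      have h5 : ∑ e : EdgeT r, (if e.1.1 = e.1.2 then 0 else (netV x e.1.1 * netV x e.1.2)^2)
          = ∑ e : EdgeT r, (netV x e.1.1 * netV x e.1.2)^2 := by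
        apply Finset.sum_congr rfl
        intro e _
        rw [if_neg (ne_of_lt e.2)]
      rw [h5] at h4
      linarith
    simp only [div_pow, ← Finset.sum_div]
    rw [div_le_iff₀ (by positivity)]
    linarith
  have hsum := Finset.sum_le_sum hx
  rw [Finset.sum_const, nsmul_eq_mul] at hsum
  refine mul_le_mul_of_nonneg_left (hsum.trans ?_) hr0.le
  have hc := netT_card r
  calc ((netT r).card : ℝ) * (2 * (4 * k * Real.exp (4 * (81/2))) ^ k)
      ≤ 2 ^ (11 * r) * (2^k * (4 * k * Real.exp (4 * (81/2))) ^ k) := by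
        gcongr
        calc (2:ℝ) = 2^1 := by norm_num
          _ ≤ 2^k := pow_le_pow_right₀ (by norm_num) hk
    _ = (2 ^ 22 * 2 * 4 * k * Real.exp 162) ^ k := by
        rw [hr, show 11 * (2*k) = 22 * k by ring, pow_mul, ← mul_pow, ← mul_pow]
        congr 1
        norm_num
        ring
    _ ≤ _ := by
        apply pow_le_pow_left₀ (by positivity)
        have : (2:ℝ)^25 ≤ Real.exp 25 := by
          have h := Real.add_one_le_exp (1:ℝ)
          calc (2:ℝ)^25 ≤ (Real.exp 1)^25 := pow_le_pow_left₀ (by norm_num) (by linarith) _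
            _ = Real.exp 25 := by rw [← Real.exp_nat_mul]; norm_num
        calc (2:ℝ) ^ 22 * 2 * 4 * k * Real.exp 162 = 2^25 * Real.exp 162 * k := by ring
          _ ≤ Real.exp 25 * Real.exp 162 * k := by gcongr
          _ = _ := by rw [← Real.exp_add]; norm_num

section DetPart
open scoped Matrix.Norms.L2Operator

lemma orth_norm_le {n : ℕ} (V : Matrix (Fin n) (Fin n) ℝ) (h : V * Vᵀ = 1) : ‖V‖ ≤ 1 := by
  have h1 : ‖V * star V‖ = ‖V‖ * ‖V‖ := CStarRing.norm_self_mul_star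
  rw [Matrix.star_eq_conjTranspose, Matrix.conjTranspose_eq_transpose_of_trivial, h] at h1
  have h2 : ‖(1 : Matrix (Fin n) (Fin n) ℝ)‖ ≤ 1 := by
    rw [← Matrix.diagonal_one, Matrix.l2_opNorm_diagonal, pi_norm_le_iff_of_nonneg zero_le_one]
    intro i; simp
  nlinarith [norm_nonneg V]

lemma orth_norm_le' {n : ℕ} (V : Matrix (Fin n) (Fin n) ℝ) (h : V * Vᵀ = 1) : ‖Vᵀ‖ ≤ 1 := by
  rw [← Matrix.conjTranspose_eq_transpose_of_trivial, Matrix.l2_opNorm_conjTranspose]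
  exact orth_norm_le V h

lemma norm_conj_le {n : ℕ} (V : Matrix (Fin n) (Fin n) ℝ) (h : V * Vᵀ = 1)
    (M : Matrix (Fin n) (Fin n) ℝ) : ‖V * M * Vᵀ‖ ≤ ‖M‖ := by
  calc ‖V * M * Vᵀ‖ ≤ ‖V * M‖ * ‖Vᵀ‖ := norm_mul_le _ _
    _ ≤ ‖V * M‖ * 1 := by gcongr; exact orth_norm_le' V h
    _ ≤ (‖V‖ * ‖M‖) * 1 := by gcongr; exact norm_mul_le _ _
    _ ≤ (1 * ‖M‖) * 1 := by gcongr; exact orth_norm_le V h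
    _ = _ := by ring

lemma norm_conj_diag_le {n : ℕ} (V : Matrix (Fin n) (Fin n) ℝ) (h : V * Vᵀ = 1)
    (d : Fin n → ℝ) (L : ℝ) (hL : 0 ≤ L) (hd : ∀ i, |d i| ≤ L) :
    ‖V * Matrix.diagonal d * Vᵀ‖ ≤ L := by
  refine (norm_conj_le V h _).trans ?_
  rw [Matrix.l2_opNorm_diagonal, pi_norm_le_iff_of_nonneg hL]
  intro i
  rw [Real.norm_eq_abs]
  exact hd i

lemma eig_le_norm {n : ℕ} (V : Matrix (Fin n) (Fin n) ℝ) (h : Vᵀ * V = 1)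
    (d : Fin n → ℝ) (i : Fin n) : |d i| ≤ ‖V * Matrix.diagonal d * Vᵀ‖ := by
  have h1 : Vᵀ * (V * Matrix.diagonal d * Vᵀ) * Vᵀᵀ = Matrix.diagonal d := by
    rw [Matrix.transpose_transpose]
    calc Vᵀ * (V * Matrix.diagonal d * Vᵀ) * V = (Vᵀ * V) * Matrix.diagonal d * (Vᵀ * V) := by
          simp only [Matrix.mul_assoc]
      _ = _ := by rw [h]; simp
  have h2 := norm_conj_le Vᵀ (by rw [Matrix.transpose_transpose]; exact h)
    (V * Matrix.diagonal d * Vᵀ)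
  rw [h1, Matrix.l2_opNorm_diagonal] at h2
  exact (norm_le_pi_norm d i).trans h2

lemma norm_le_of_trace {n k : ℕ} (hk : 1 ≤ k) (M : Matrix (Fin n) (Fin n) ℝ) (hM : M.IsSymm)
    (L : ℝ) (hL : 0 ≤ L) (h : (M ^ (2*k)).trace ≤ L ^ (2*k)) : ‖M‖ ≤ L := by
  obtain ⟨V, lam, h1, h2, h3, _⟩ := spectral_exists M hM
  rw [h3, orth_conj_pow V lam h1 h2, trace_conj _ _ h2] at h
  rw [h3]
  apply norm_conj_diag_le V h1 _ _ hL
  intro i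
  have h4 : lam i ^ (2*k) ≤ L ^ (2*k) := (Finset.single_le_sum (f := fun i => lam i ^ (2*k))
    (fun _ _ => Even.pow_nonneg (even_two_mul k) _) (Finset.mem_univ i)).trans h
  rw [← Even.pow_abs (even_two_mul k)] at h4
  exact (pow_le_pow_iff_left₀ (abs_nonneg _) hL (by omega)).1 h4

lemma frob_le {n : ℕ} (M : Matrix (Fin n) (Fin n) ℝ) (hM : M.IsSymm) :
    ∑ i, ∑ j, M i j ^ 2 ≤ M.rank * ‖M‖ ^ 2 := by
  obtain ⟨V, lam, h1, h2, h3, h4⟩ := spectral_exists M hM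
  have h5 : ∑ i, ∑ j, M i j ^ 2 = (M ^ 2).trace := by
    rw [sq M]
    simp only [Matrix.trace, Matrix.diag, Matrix.mul_apply]
    apply Finset.sum_congr rfl; intro i _
    apply Finset.sum_congr rfl; intro j _
    rw [hM.apply i j, sq]
  have h6 : (M^2).trace = ∑ i, lam i ^ 2 := by
    rw [h3, orth_conj_pow V lam h1 h2, trace_conj _ _ h2]
  rw [h5, h6, h4]
  calc ∑ i, lam i ^ 2 = ∑ i ∈ Finset.univ.filter (fun i => lam i ≠ 0), lam i ^ 2 := by
        rw [Finset.sum_filter]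
        apply Finset.sum_congr rfl; intro i _
        by_cases h : lam i = 0 <;> simp [h]
    _ ≤ ∑ i ∈ Finset.univ.filter (fun i => lam i ≠ 0), ‖M‖ ^ 2 := by
        apply Finset.sum_le_sum; intro i _
        rw [← sq_abs]
        apply pow_le_pow_left₀ (abs_nonneg _)
        conv_rhs => rw [h3]
        exact eig_le_norm V h2 lam i
    _ = _ := by rw [Finset.sum_const, nsmul_eq_mul]

lemma sqrt_mulVec_le {n : ℕ} (M : Matrix (Fin n) (Fin n) ℝ) (x : Fin n → ℝ) :
    Real.sqrt (∑ i, (M *ᵥ x) i ^ 2) ≤ ‖M‖ * Real.sqrt (∑ i, x i ^ 2) := by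
  have := Matrix.l2_opNorm_mulVec M (WithLp.toLp 2 x)
  simpa [EuclideanSpace.norm_eq] using this

lemma sqrt_add_le' {n : ℕ} (x y : Fin n → ℝ) :
    Real.sqrt (∑ i, (x i + y i) ^ 2) ≤ Real.sqrt (∑ i, x i ^ 2) + Real.sqrt (∑ i, y i ^ 2) := by
  have := norm_add_le (WithLp.toLp 2 x : EuclideanSpace ℝ (Fin n)) (WithLp.toLp 2 y)
  simpa [EuclideanSpace.norm_eq] using this

lemma norm_orth_mul {n : ℕ} (V : Matrix (Fin n) (Fin n) ℝ) (h2 : Vᵀ * V = 1) (x : Fin n → ℝ) :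
    ∑ i, (V *ᵥ x) i ^ 2 = ∑ i, x i ^ 2 := by
  have := norm_orth Vᵀ (by rw [Matrix.transpose_transpose]; exact h2) x
  rwa [Matrix.transpose_transpose] at this

lemma weyl {n : ℕ} (A P W V : Matrix (Fin n) (Fin n) ℝ) (mu lam : Fin n → ℝ)
    (hA : IsEigenDecomp A W mu) (hP : IsEigenDecomp P V lam) (r : Fin n) :
    |mu r| ≤ |lam r| + ‖A - P‖ := by
  obtain ⟨hW1, hA2, hA3⟩ := hA
  obtain ⟨hV1, hP2, hP3⟩ := hP
  have hW2 : Wᵀ * W = 1 := mul_eq_one_comm.1 hW1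
  have hV2 : Vᵀ * V = 1 := mul_eq_one_comm.1 hV1
  let L : (Fin n → ℝ) →ₗ[ℝ] ({i : Fin n // i ≠ r} → ℝ) := LinearMap.pi fun i =>
    if i.1 < r then (LinearMap.proj i.1).comp (Matrix.mulVecLin (Vᵀ * W)) else LinearMap.proj i.1
  have hker : LinearMap.ker L ≠ ⊥ := by
    apply LinearMap.ker_ne_bot_of_finrank_lt
    simp only [Module.finrank_fintype_fun_eq_card, Fintype.card_fin]
    have : Fintype.card {i : Fin n // i ≠ r} < Fintype.card (Fin n) :=
      Fintype.card_subtype_lt (x := r) (by simp)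
    simpa using this
  obtain ⟨y, hy, hy0⟩ := (Submodule.ne_bot_iff _).1 hker
  have hLy : ∀ i : {i : Fin n // i ≠ r}, L y i = 0 := fun i => congrFun (LinearMap.mem_ker.1 hy) i
  have hlow : ∀ i : Fin n, i < r → ((Vᵀ * W) *ᵥ y) i = 0 := by
    intro i hi
    have := hLy ⟨i, ne_of_lt hi⟩
    simp only [L, LinearMap.pi_apply, if_pos hi, LinearMap.comp_apply, Matrix.mulVecLin_apply,
      LinearMap.proj_apply] at this
    exact this
  have hhigh : ∀ i : Fin n, r < i → y i = 0 := by
    intro i hi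
    have := hLy ⟨i, ne_of_gt hi⟩
    simpa [L, not_lt.2 hi.le] using this
  set x := W *ᵥ y with hx
  have hxn : ∑ i, x i ^ 2 = ∑ i, y i ^ 2 := norm_orth_mul W hW2 y
  have hWx : Wᵀ *ᵥ x = y := by rw [hx, Matrix.mulVec_mulVec, hW2, Matrix.one_mulVec]
  set S := ∑ i, y i ^ 2 with hS
  have hSpos : 0 < S := by
    rcases (Finset.sum_nonneg (fun i (_ : i ∈ Finset.univ) => sq_nonneg (y i))).lt_or_eq with h | h
    · exact h
    · exfalso
      apply hy0
      ext i
      have := (Finset.sum_eq_zero_iff_of_nonneg (fun i _ => sq_nonneg (y i))).1 h.symm i (Finset.mem_univ i)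
      simpa using this
  have hAx : |mu r| ^ 2 * S ≤ ∑ i, (A *ᵥ x) i ^ 2 := by
    rw [hA2, ← Matrix.mulVec_mulVec, hWx, ← Matrix.mulVec_mulVec, norm_orth_mul W hW2, hS, Finset.mul_sum]
    apply Finset.sum_le_sum
    intro i _
    rw [Matrix.mulVec_diagonal, mul_pow, ← sq_abs (mu i)]
    rcases lt_or_ge r i with h | h
    · rw [hhigh i h]; simp
    · exact mul_le_mul_of_nonneg_right (pow_le_pow_left₀ (abs_nonneg _) (hA3 i r h) 2) (sq_nonneg _)
  have hPx : ∑ i, (P *ᵥ x) i ^ 2 ≤ |lam r| ^ 2 * S := by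
    rw [hP2, ← Matrix.mulVec_mulVec, ← Matrix.mulVec_mulVec, norm_orth_mul V hV2, ← hxn,
      ← norm_orth V hV1 x, Finset.mul_sum]
    apply Finset.sum_le_sum
    intro i _
    rw [Matrix.mulVec_diagonal, mul_pow, ← sq_abs (lam i)]
    rcases lt_or_ge i r with h | h
    · have h0 := hlow i h
      rw [← Matrix.mulVec_mulVec, ← hx] at h0
      rw [h0]; simp
    · exact mul_le_mul_of_nonneg_right (pow_le_pow_left₀ (abs_nonneg _) (hP3 r i h) 2) (sq_nonneg _)
  have htri := sqrt_add_le' (P *ᵥ x) ((A - P) *ᵥ x)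
  have hsum : ∀ i, (P *ᵥ x) i + ((A - P) *ᵥ x) i = (A *ᵥ x) i := by
    intro i; rw [Matrix.sub_mulVec]; simp
  simp only [hsum] at htri
  have h1 := Real.sqrt_le_sqrt hAx
  have h2 := Real.sqrt_le_sqrt hPx
  have h3 := sqrt_mulVec_le (A - P) x
  rw [Real.sqrt_mul (by positivity), Real.sqrt_sq (abs_nonneg _)] at h1 h2
  rw [hxn] at h3
  have hsp := Real.sqrt_pos.2 hSpos
  refine le_of_mul_le_mul_right ?_ hsp
  linarith

lemma rank_sub_le' {n : ℕ} (M N : Matrix (Fin n) (Fin n) ℝ) : (M - N).rank ≤ M.rank + N.rank := by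
  unfold Matrix.rank
  refine le_trans (Submodule.finrank_mono (t := LinearMap.range M.mulVecLin ⊔ LinearMap.range N.mulVecLin) ?_)
    (Submodule.finrank_add_le_finrank_add_finrank _ _)
  rintro _ ⟨x, rfl⟩
  rw [Matrix.mulVecLin_apply, Matrix.sub_mulVec]
  exact Submodule.sub_mem _ (Submodule.mem_sup_left ⟨x, rfl⟩) (Submodule.mem_sup_right ⟨x, rfl⟩)

lemma trunc_bound {n : ℕ} (A P T V : Matrix (Fin n) (Fin n) ℝ) (lam : Fin n → ℝ) (r : ℕ) (hrn : r < n)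
    (hPs : P.IsSymm)
    (hP : IsEigenDecomp P V lam) (hT : IsSpecTrunc r A T) :
    ∑ i, ∑ j, (T - P) i j ^ 2 ≤ (r + P.rank) * (|lam ⟨r, hrn⟩| + 2 * ‖A - P‖) ^ 2 := by
  obtain ⟨W, mu, hA, rfl⟩ := hT
  set d : Fin n → ℝ := fun i : Fin n => if (i : ℕ) < r then mu i else 0 with hd
  have hw := weyl A P W V mu lam hA hP ⟨r, hrn⟩
  have h1 : ‖W * Matrix.diagonal d * Wᵀ - A‖ ≤ |mu ⟨r, hrn⟩| := by
    have h2 : W * Matrix.diagonal d * Wᵀ - A = W * Matrix.diagonal (fun i => d i - mu i) * Wᵀ := by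
      conv_lhs => rw [hA.2.1]
      rw [← Matrix.sub_mul, ← Matrix.mul_sub, Matrix.diagonal_sub]
    rw [h2]
    apply norm_conj_diag_le W hA.1 _ _ (abs_nonneg _)
    intro i
    simp only [hd]
    split_ifs with h
    · simp
    · rw [zero_sub, abs_neg]
      exact hA.2.2 _ _ (by rw [Fin.le_def]; exact not_lt.1 h)
  have h3 : ‖W * Matrix.diagonal d * Wᵀ - P‖ ≤ |lam ⟨r, hrn⟩| + 2 * ‖A - P‖ := by
    have := norm_add_le (W * Matrix.diagonal d * Wᵀ - A) (A - P)
    rw [sub_add_sub_cancel] at this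
    linarith
  have hsym : (W * Matrix.diagonal d * Wᵀ - P).IsSymm := by
    apply Matrix.IsSymm.sub _ hPs
    rw [Matrix.IsSymm, Matrix.transpose_mul, Matrix.transpose_mul, Matrix.transpose_transpose,
      Matrix.diagonal_transpose, Matrix.mul_assoc]
  have hrank : (W * Matrix.diagonal d * Wᵀ - P).rank ≤ r + P.rank := by
    have e1 : (W * Matrix.diagonal d * Wᵀ).rank ≤ r := by
      refine ((Matrix.rank_mul_le_left _ _).trans (Matrix.rank_mul_le_right _ _)).trans ?_
      rw [Matrix.rank_diagonal, Fintype.card_subtype]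
      calc _ ≤ (Finset.univ.filter (fun i : Fin n => (i:ℕ) < r)).card := by
            apply Finset.card_le_card
            intro i
            simp only [Finset.mem_filter, Finset.mem_univ, true_and, hd]
            intro h
            by_contra h'
            exact h (if_neg h')
        _ ≤ r := by
            rw [Fin.card_filter_val_lt]; exact min_le_right _ _
    exact (rank_sub_le' _ _).trans (Nat.add_le_add_right e1 _)
  refine (frob_le _ hsym).trans ?_
  have : ((W * Matrix.diagonal d * Wᵀ - P).rank : ℝ) ≤ r + P.rank := by exact_mod_cast hrank
  gcongr

end DetPart

/-! ### Rows -/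

lemma center_apply {n : ℕ} (M : Matrix (Fin n) (Fin n) ℝ) (i j : Fin n) :
    (M * centerH n) i j = M i j - (n:ℝ)⁻¹ * ∑ l, M i l := by
  rw [centerH, Matrix.mul_sub, Matrix.mul_one, Matrix.mul_smul]
  simp [Matrix.mul_apply]

lemma center_sq_le {n : ℕ} (hn : 0 < n) (a : Fin n → ℝ) (c : ℝ) :
    ∑ j, (a j - (n:ℝ)⁻¹ * ∑ l, a l) ^ 2 ≤ ∑ j, (a j - c) ^ 2 := by
  have hn' : (0:ℝ) < n := by exact_mod_cast hn
  set b := (n:ℝ)⁻¹ * ∑ l, a l with hb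
  have h1 : ∑ l, a l = n * b := by rw [hb]; field_simp
  have h2 : ∑ j, (a j - c) ^ 2 = ∑ j, (a j - b) ^ 2 + n * (b - c)^2 := by
    have : ∀ j, (a j - c)^2 = (a j - b)^2 + ((2 * (b - c)) * a j + (c^2 - b^2)) := by
      intro j; ring
    simp only [this, Finset.sum_add_distrib, ← Finset.mul_sum, h1, Finset.sum_const,
      Finset.card_univ, Fintype.card_fin, nsmul_eq_mul]
    ring
  rw [h2]
  nlinarith [sq_nonneg (b - c)]

lemma rowNorm_center_diff {n : ℕ} (hn : 0 < n) (M N : Matrix (Fin n) (Fin n) ℝ) (i : Fin n) :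
    rowNorm (M * centerH n) i ≤ rowNorm (N * centerH n) i + rowNorm (M - N) i := by
  unfold rowNorm
  have h1 := sqrt_add_le' (fun j => (N * centerH n) i j) (fun j => ((M - N) * centerH n) i j)
  have h2 : ∀ j, (N * centerH n) i j + ((M - N) * centerH n) i j = (M * centerH n) i j := by
    intro j; rw [Matrix.sub_mul]; simp
  simp only [h2] at h1
  refine h1.trans ?_
  have h3 := center_sq_le hn (fun j => (M - N) i j) 0
  simp only [sub_zero, ← center_apply] at h3
  exact add_le_add le_rfl (Real.sqrt_le_sqrt h3)

lemma rowNorm_comm {n : ℕ} (M N : Matrix (Fin n) (Fin n) ℝ) (i : Fin n) :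
    rowNorm (M - N) i = rowNorm (N - M) i := by
  unfold rowNorm
  congr 1
  apply Finset.sum_congr rfl
  intro j _
  simp only [Matrix.sub_apply]
  ring

lemma le_pstar {n : ℕ} (P : Matrix (Fin n) (Fin n) ℝ) (i j : Fin n) : P i j ≤ pstar P := by
  refine (le_ciSup (f := fun j => P i j) (Set.finite_range _).bddAbove j).trans ?_
  exact le_ciSup (f := fun i => ⨆ j, P i j) (Set.finite_range _).bddAbove i

lemma periphery_row {n : ℕ} (hn : 2 ≤ n) (P : Matrix (Fin n) (Fin n) ℝ) (hP : IsProbMatrix P)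
    (i : Fin n) (hi : i ∉ coreER P) : rowNorm (P * centerH n) i ≤ pstar P := by
  classical
  rw [coreER, Finset.mem_compl, not_not, peripheryER, Finset.mem_filter] at hi
  have : Nontrivial (Fin n) := Fin.nontrivial_iff_two_le.2 hn
  obtain ⟨j0, hj0⟩ := exists_ne i
  have hc0 := hP.2.1 i j0
  refine le_trans ?_ (le_pstar P i j0)
  unfold rowNorm
  apply Real.sqrt_le_iff.2 ⟨hc0, ?_⟩
  simp only [center_apply]
  refine (center_sq_le (by omega) (fun j => P i j) (P i j0)).trans ?_
  rw [Finset.sum_eq_single_of_mem i (Finset.mem_univ _)]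
  · rw [hP.2.2.2 i]; simp
  · intro j _ hj
    rw [hi.2 j j0 hj hj0]; simp

lemma count_bound {n : ℕ} (hn : 2 ≤ n) (P T : Matrix (Fin n) (Fin n) ℝ) (hP : IsProbMatrix P)
    (hsig : pstar P < hSignal P) (Chat : Finset (Fin n)) (hc : Chat.card = (coreER P).card)
    (hS : ∀ i ∈ Chat, ∀ j ∉ Chat, rowNorm (T * centerH n) j ≤ rowNorm (T * centerH n) i) :
    (((coreER P) \ Chat).card : ℝ) * (hSignal P - pstar P) ^ 2 ≤
      2 * ∑ i, ∑ j, (T - P) i j ^ 2 := by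
  set C := coreER P with hC
  set ε : Fin n → ℝ := fun i => rowNorm (T - P) i with hε
  have hε2 : ∀ i, ε i ^ 2 = ∑ j, (T - P) i j ^ 2 := fun i =>
    Real.sq_sqrt (Finset.sum_nonneg fun _ _ => sq_nonneg _)
  have hcard : (Chat \ C).card = (C \ Chat).card := by
    have h1 := Finset.card_sdiff_add_card_inter Chat C
    have h2 := Finset.card_sdiff_add_card_inter C Chat
    rw [Finset.inter_comm] at h2
    omega
  have hpair : ∀ i ∈ C \ Chat, ∀ j ∈ Chat \ C, (hSignal P - pstar P)^2 ≤ 2 * ε i ^ 2 + 2 * ε j ^ 2 := by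
    intro i hi j hj
    rw [Finset.mem_sdiff] at hi hj
    have h1 : hSignal P ≤ rowNorm (P * centerH n) i :=
      ciInf_le (f := fun i : {i // i ∈ coreER P} => rowNorm (P * centerH n) i.1)
        (Set.finite_range _).bddBelow ⟨i, hi.1⟩
    have h2 := rowNorm_center_diff (by omega : 0 < n) P T i
    rw [rowNorm_comm] at h2
    have h3 := rowNorm_center_diff (by omega : 0 < n) T P j
    have h4 := periphery_row hn P hP j hj.2
    have h5 := hS j hj.1 i hi.2
    have h6 : hSignal P - pstar P ≤ ε i + ε j := by
      simp only [hε]; linarith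
    have h7 : (hSignal P - pstar P)^2 ≤ (ε i + ε j)^2 := pow_le_pow_left₀ (by linarith) h6 2
    nlinarith [sq_nonneg (ε i - ε j)]
  rcases Nat.eq_zero_or_pos (C \ Chat).card with h0 | h0
  · rw [h0]
    simp only [Nat.cast_zero, zero_mul]
    apply mul_nonneg (by norm_num)
    exact Finset.sum_nonneg fun _ _ => Finset.sum_nonneg fun _ _ => sq_nonneg _
  have hM : (0:ℝ) < (C \ Chat).card := by exact_mod_cast h0
  have hsum := Finset.sum_le_sum fun i hi => Finset.sum_le_sum fun j hj => hpair i hi j hj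
  simp only [Finset.sum_add_distrib, Finset.sum_const, nsmul_eq_mul, hcard, ← Finset.mul_sum] at hsum
  have hdisj : Disjoint (C \ Chat) (Chat \ C) := by
    rw [Finset.disjoint_left]
    intro a ha hb
    rw [Finset.mem_sdiff] at ha hb
    exact ha.2 hb.1
  have htot : ∑ i ∈ C \ Chat, ε i ^ 2 + ∑ i ∈ Chat \ C, ε i ^ 2 ≤ ∑ i, ∑ j, (T - P) i j ^ 2 := by
    rw [← Finset.sum_union hdisj]
    simp only [← hε2]
    exact Finset.sum_le_sum_of_subset_of_nonneg (Finset.subset_univ _) fun _ _ _ => sq_nonneg _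
  refine le_of_mul_le_mul_left ?_ hM
  nlinarith

/-! ### The adjacency model and the final assembly -/

section Assembly

lemma pstar_nonneg {n : ℕ} (hn : 2 ≤ n) (P : Matrix (Fin n) (Fin n) ℝ) (hP : IsProbMatrix P) :
    0 ≤ pstar P := (hP.2.1 ⟨0, by omega⟩ ⟨0, by omega⟩).trans (le_pstar P _ _)

lemma pstar_le_one {n : ℕ} (hn : 2 ≤ n) (P : Matrix (Fin n) (Fin n) ℝ) (hP : IsProbMatrix P) :
    pstar P ≤ 1 := by
  have : Nonempty (Fin n) := ⟨⟨0, by omega⟩⟩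
  exact ciSup_le fun i => ciSup_le fun j => hP.2.2.1 i j

lemma adj_mean {n : ℕ} {Ω : Type*} [MeasurableSpace Ω] (μ : Measure Ω)
    [IsProbabilityMeasure μ] (P : Matrix (Fin n) (Fin n) ℝ) (hP : IsProbMatrix P)
    (A : Ω → Matrix (Fin n) (Fin n) ℝ) (hA : IsAdjacencyModel μ P A) (e : EdgeT n) :
    Integrable (fun ω => A ω e.1.1 e.1.2) μ ∧ ∫ ω, A ω e.1.1 e.1.2 ∂μ = P e.1.1 e.1.2 := by
  obtain ⟨_, _, h3, h4, h5, _⟩ := hA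
  have hm := h4 e.1.1 e.1.2
  have hS : MeasurableSet {ω | A ω e.1.1 e.1.2 = 1} := hm (measurableSet_singleton 1)
  have heq : (fun ω => A ω e.1.1 e.1.2) =
      Set.indicator {ω | A ω e.1.1 e.1.2 = 1} (fun _ => (1:ℝ)) := by
    funext ω
    by_cases h : A ω e.1.1 e.1.2 = 1
    · rw [Set.indicator_of_mem (by exact h), h]
    · rw [Set.indicator_of_notMem (by exact h)]
      exact (h3 ω _ _).resolve_right h
  rw [heq]
  constructor
  · exact (integrable_const _).indicator hS
  · rw [integral_indicator_const _ hS, measureReal_def, h5 _ _ e.2,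
      ENNReal.toReal_ofReal (hP.2.1 _ _)]
    simp

lemma adj_trace {n : ℕ} (hn : 2 ≤ n) {Ω : Type*} [MeasurableSpace Ω] (μ : Measure Ω)
    [IsProbabilityMeasure μ] (P : Matrix (Fin n) (Fin n) ℝ) (hP : IsProbMatrix P)
    (A : Ω → Matrix (Fin n) (Fin n) ℝ) (hA : IsAdjacencyModel μ P A) (k : ℕ) (hk : 1 ≤ k)
    (hkp : n * pstar P ≤ k) :
    Integrable (fun ω => ((A ω - P) ^ (2*k)).trace) μ ∧
      ∫ ω, ((A ω - P) ^ (2*k)).trace ∂μ ≤ n * (Real.exp 187 * k) ^ k := by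
  have hmean := adj_mean μ P hP A hA
  obtain ⟨h1, h2, h3, h4, h5, h6⟩ := hA
  have hp0 := pstar_nonneg hn P hP
  have hup := adj_trace_upper μ (pstar P) hp0 (pstar_le_one hn P hP) (fun ω => A ω - P)
    (fun ω => (h1 ω).sub hP.1) (fun ω i => by simp [h2 ω i, hP.2.2.2 i])
    (fun i j => by
      simp only [Matrix.sub_apply]
      exact (h4 i j).sub_const _)
    (fun ω i j => by
      have e1 := hP.2.1 i j
      have e2 := hP.2.2.1 i j
      rw [Matrix.sub_apply, abs_le]
      rcases h3 ω i j with h | h <;> rw [h] <;> constructor <;> linarith)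
    (fun e => by
      simp only [Matrix.sub_apply]
      rw [integral_sub (hmean e).1 (integrable_const _), (hmean e).2]
      simp)
    (fun e => by
      have hsq : ∀ ω, (A ω - P) e.1.1 e.1.2 ^ 2 =
          (1 - 2 * P e.1.1 e.1.2) * A ω e.1.1 e.1.2 + P e.1.1 e.1.2 ^ 2 := by
        intro ω
        rw [Matrix.sub_apply]
        rcases h3 ω e.1.1 e.1.2 with h | h <;> rw [h] <;> ring
      simp only [hsq]
      rw [integral_add ((hmean e).1.const_mul _) (integrable_const _), integral_const_mul,
        (hmean e).2]
      have := le_pstar P e.1.1 e.1.2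
      simp only [integral_const, probReal_univ, smul_eq_mul, one_mul]
      nlinarith [sq_nonneg (P e.1.1 e.1.2)])
    (by
      have := h6.comp (fun e x => x - P e.1.1 e.1.2) (fun e => by fun_prop)
      exact this)
    (2*k)
  refine ⟨hup.1, hup.2.trans ?_⟩
  have hc := walk_compare n (2*k) k (pstar P) hp0 (by push_cast; linarith)
  have hl := rE_trace_lower (2*k) (2*k)
  have hu := rE_trace_upper k hk
  have hk0 : (0:ℝ) < ((2*k : ℕ) : ℝ) := by exact_mod_cast (by omega : 0 < 2 * k)
  have hn0 : (0:ℝ) ≤ n := Nat.cast_nonneg n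
  refine le_of_mul_le_mul_left ?_ hk0
  refine hc.trans ?_
  have := mul_le_mul_of_nonneg_left (hl.trans hu) hn0
  linarith

lemma trace_even_nonneg {n : ℕ} (M : Matrix (Fin n) (Fin n) ℝ) (hM : M.IsSymm) (k : ℕ) :
    0 ≤ (M ^ (2*k)).trace := by
  obtain ⟨V, lam, h1, h2, h3, _⟩ := spectral_exists M hM
  rw [h3, orth_conj_pow V lam h1 h2, trace_conj _ _ h2]
  exact Finset.sum_nonneg fun _ _ => Even.pow_nonneg (even_two_mul k) _

lemma adj_prob {n : ℕ} (hn : 2 ≤ n) {Ω : Type*} [MeasurableSpace Ω] (μ : Measure Ω)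
    [IsProbabilityMeasure μ] (P : Matrix (Fin n) (Fin n) ℝ) (hP : IsProbMatrix P)
    (A : Ω → Matrix (Fin n) (Fin n) ℝ) (hA : IsAdjacencyModel μ P A) (k : ℕ) (hk : 1 ≤ k)
    (hkp : n * pstar P ≤ k) (hkl : Real.log n ≤ k) :
    ENNReal.ofReal (1 - (n:ℝ) ^ (-(1:ℝ))) ≤
      μ {ω | ((A ω - P) ^ (2*k)).trace ≤ (Real.exp 1 * Real.sqrt (Real.exp 187 * k)) ^ (2*k)} := by
  obtain ⟨hIntegr, hle⟩ := adj_trace hn μ P hP A hA k hk hkp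
  set T := (Real.exp 1 * Real.sqrt (Real.exp 187 * k)) ^ (2*k) with hT
  have hn0 : (0:ℝ) < n := by exact_mod_cast (by omega : 0 < n)
  have hk0 : (0:ℝ) < k := by exact_mod_cast (by omega : 0 < k)
  set Q := (Real.exp 187 * k) ^ k with hQ
  have hQpos : 0 < Q := by positivity
  have hTQ : T = Real.exp k ^ 2 * Q := by
    rw [hT, hQ, mul_pow, pow_mul (Real.sqrt _), Real.sq_sqrt (by positivity), ← Real.exp_nat_mul,
      ← Real.exp_nat_mul]
    push_cast
    ring_nf
  have hnk : (n:ℝ) ≤ Real.exp k := by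
    rw [← Real.exp_log hn0]; exact Real.exp_le_exp.2 hkl
  have hmark := mul_meas_ge_le_integral_of_nonneg (μ := μ)
    (ae_of_all μ fun ω => trace_even_nonneg (A ω - P) ((hA.1 ω).sub hP.1) k) hIntegr T
  set S := {ω | T ≤ ((A ω - P) ^ (2*k)).trace} with hS
  have hSr : μ.real S ≤ (n:ℝ)⁻¹ := by
    have e1 : (n:ℝ)^2 * Q * μ.real S ≤ n * Q := by
      refine le_trans ?_ (hmark.trans hle)
      rw [hTQ]
      gcongr
    rw [inv_eq_one_div, le_div_iff₀ hn0]
    have hnQ : 0 < n * Q := by positivity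
    refine le_of_mul_le_mul_left ?_ hnQ
    linarith
  have hcov : 1 ≤ μ.real S + μ.real Sᶜ := by
    have := measureReal_union_le (μ := μ) S Sᶜ
    rwa [Set.union_compl_self, probReal_univ] at this
  rw [Real.rpow_neg_one]
  calc ENNReal.ofReal (1 - (n:ℝ)⁻¹) ≤ ENNReal.ofReal (μ.real Sᶜ) :=
        ENNReal.ofReal_le_ofReal (by linarith)
    _ = μ Sᶜ := ofReal_measureReal
    _ ≤ _ := measure_mono fun ω hω => by
        simp only [hS, Set.mem_compl_iff, Set.mem_setOf_eq, not_le] at hω ⊢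
        exact hω.le

open scoped Matrix.Norms.L2Operator in
lemma det_final {n : ℕ} (hn : 2 ≤ n) (A P T V : Matrix (Fin n) (Fin n) ℝ) (lam : Fin n → ℝ)
    (r : ℕ) (hrn : r < n) (hAs : A.IsSymm) (hPm : IsProbMatrix P)
    (hsig : pstar P < hSignal P)
    (hP : IsEigenDecomp P V lam) (hT : IsSpecTrunc r A T) (k : ℕ) (hk : 1 ≤ k) (L : ℝ)
    (hL : 0 ≤ L) (htr : ((A - P) ^ (2*k)).trace ≤ L ^ (2*k))
    (K B : ℝ) (hK : 1 ≤ 2 * K) (hB : 0 ≤ B) (hLK : L ≤ K * B)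
    (Chat : Finset (Fin n)) (hc : Chat.card = (coreER P).card)
    (hS : ∀ i ∈ Chat, ∀ j ∉ Chat, rowNorm (T * centerH n) j ≤ rowNorm (T * centerH n) i) :
    (((coreER P) \ Chat).card : ℝ) ≤
      4 * (2 * K) ^ 2 * max (r : ℝ) (P.rank : ℝ) * (B + |lam ⟨r, hrn⟩|) ^ 2
        / (hSignal P - pstar P) ^ 2 := by
  have h1 := count_bound hn P T hPm hsig Chat hc hS
  have h2 := trunc_bound A P T V lam r hrn hPm.1 hP hT
  have h3 := norm_le_of_trace hk (A - P) (hAs.sub hPm.1) L hL htr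
  have hpos : 0 < (hSignal P - pstar P) ^ 2 := pow_pos (by linarith) 2
  rw [le_div_iff₀ hpos]
  refine h1.trans ?_
  have h4 : |lam ⟨r, hrn⟩| + 2 * ‖A - P‖ ≤ 2 * K * (B + |lam ⟨r, hrn⟩|) := by
    have := mul_le_mul_of_nonneg_right hK (abs_nonneg (lam ⟨r, hrn⟩))
    linarith
  have h5 : (|lam ⟨r, hrn⟩| + 2 * ‖A - P‖) ^ 2 ≤ (2 * K * (B + |lam ⟨r, hrn⟩|)) ^ 2 :=
    pow_le_pow_left₀ (by positivity) h4 2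
  have h6 : (r:ℝ) + P.rank ≤ 2 * max (r : ℝ) (P.rank : ℝ) := by
    linarith [le_max_left (r:ℝ) (P.rank : ℝ), le_max_right (r:ℝ) (P.rank : ℝ)]
  calc 2 * ∑ i, ∑ j, (T - P) i j ^ 2
      ≤ 2 * ((r + P.rank) * (|lam ⟨r, hrn⟩| + 2 * ‖A - P‖) ^ 2) := by linarith
    _ ≤ 2 * ((2 * max (r : ℝ) (P.rank : ℝ)) * (2 * K * (B + |lam ⟨r, hrn⟩|)) ^ 2) := by
        gcongr
    _ = _ := by ring

end Assembly

/-- weak consistency (misclassification bound) under the ER-type model. -/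
theorem er_weak_consistency :
    ∃ (C γ : ℝ) (N₀ : ℕ), 0 < C ∧ 0 < γ ∧
      ∀ (n : ℕ) (hN : N₀ ≤ n) (hn : 2 ≤ n)
        (P : Matrix (Fin n) (Fin n) ℝ) (hP : IsProbMatrix P)
        (hsig : pstar P < hSignal P)
        (r : ℕ) (hr1 : 1 ≤ r) (hrn : r < n)
        (V : Matrix (Fin n) (Fin n) ℝ) (lam : Fin n → ℝ)
        (hVlam : IsEigenDecomp P V lam)
        (Ω : Type) (_ : MeasurableSpace Ω) (μ : Measure Ω) (hμ : IsProbabilityMeasure μ)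
        (A : Ω → Matrix (Fin n) (Fin n) ℝ) (hA : IsAdjacencyModel μ P A)
        (Phat : Ω → Matrix (Fin n) (Fin n) ℝ) (hPhat : ∀ ω, IsSpecTrunc r (A ω) (Phat ω)),
        ENNReal.ofReal (1 - (n : ℝ) ^ (-γ)) ≤
          μ {ω | ∀ Chat : Finset (Fin n), Chat.card = (coreER P).card →
              (∀ i ∈ Chat, ∀ j ∉ Chat,
                rowNorm (Phat ω * centerH n) j ≤ rowNorm (Phat ω * centerH n) i) →
              (((coreER P) \ Chat).card : ℝ) ≤
                C * max (r : ℝ) (P.rank : ℝ) *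
                  (max (Real.sqrt (n * pstar P)) (Real.sqrt (Real.log n))
                      + |lam ⟨r, hrn⟩|) ^ 2 / (hSignal P - pstar P) ^ 2} := by
  refine ⟨4 * (2 * (Real.exp 1 * Real.sqrt (Real.exp 187 * 2))) ^ 2, 1, 3, by positivity,
    one_pos, ?_⟩
  intro n hN hn P hP hsig r hr1 hrn V lam hVlam Ω _ μ hμ A hA Phat hPhat
  have hn0 : (0:ℝ) < n := by exact_mod_cast (by omega : 0 < n)
  have hlog : 1 ≤ Real.log n := by
    rw [Real.le_log_iff_exp_le hn0]
    have h3 : (3:ℝ) ≤ n := by exact_mod_cast hN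
    linarith [Real.exp_one_lt_d9]
  set m := max (n * pstar P) (Real.log n) with hm
  have hm1 : 1 ≤ m := hlog.trans (le_max_right _ _)
  set k := ⌈m⌉₊ with hk
  have hmk : m ≤ k := Nat.le_ceil m
  have hk1 : 1 ≤ k := by
    have : (1:ℝ) ≤ k := hm1.trans hmk
    exact_mod_cast this
  have hk2 : (k:ℝ) ≤ 2 * m := by
    have := Nat.ceil_lt_add_one (by linarith : 0 ≤ m)
    linarith
  have hB : max (Real.sqrt (n * pstar P)) (Real.sqrt (Real.log n)) = Real.sqrt m :=
    (Real.sqrt_monotone.map_max).symm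
  refine (adj_prob hn μ P hP A hA k hk1 ((le_max_left _ _).trans hmk)
    ((le_max_right _ _).trans hmk)).trans (measure_mono ?_)
  intro ω hω Chat hc hS
  refine det_final hn (A ω) P (Phat ω) V lam r hrn (hA.1 ω) hP hsig hVlam (hPhat ω) k hk1 _
    (by positivity) hω (Real.exp 1 * Real.sqrt (Real.exp 187 * 2)) _ ?_ (by positivity) ?_
    Chat hc hS
  · have e1 : 1 ≤ Real.exp 1 := Real.one_le_exp zero_le_one
    have e2 : 1 ≤ Real.sqrt (Real.exp 187 * 2) := by
      rw [Real.one_le_sqrt]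
      have : 1 ≤ Real.exp 187 := Real.one_le_exp (by norm_num)
      linarith
    nlinarith
  · rw [hB, mul_assoc, ← Real.sqrt_mul (by positivity)]
    apply mul_le_mul_of_nonneg_left _ (Real.exp_pos 1).le
    apply Real.sqrt_le_sqrt
    rw [mul_assoc]
    exact mul_le_mul_of_nonneg_left hk2 (Real.exp_pos 187).le
end
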